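/- arXiv:1009.2931 — 6 statements merged into one kernel-verified Lean document; each statement's English description precedes it below -/
import Mathlib

section
/- Let ℓ ≥ 3 be an odd integer and n ≥ 2 an integer. Then the dimension over ℂ of the degree-n homogeneous component of the quotient ring ℂ[x_0,…,x_ℓ]/J equals C(ℓ+2,2) + (n−2)·C(ℓ+1,2), which equals Σ_{i=0}^{(ℓ−1)/2} (nℓ + 1 − 4i). (This is the dimension count for the Poisson closure of the symmetric algebra of the simple sl₂(ℂ)-module V_ℓ, ℓ odd, corresponding to the decomposition S^n_σ V_ℓ ≅ ⊕_{i=0}^{(ℓ−1)/2} V_{nℓ−4i} of the paper's Main Theorem.) -/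
open MvPolynomial

/-- The derivation `E` on `ℂ[x_0,…,x_ℓ]` with `E(x_i) = i·x_{i−1}` (and `x_{−1} = 0`;
the `Fin` subtraction `i - 1` wraps around at `i = 0`, but there the coefficient vanishes). -/
noncomputable def Ederiv (ℓ : ℕ) :
    Derivation ℂ (MvPolynomial (Fin (ℓ + 1)) ℂ) (MvPolynomial (Fin (ℓ + 1)) ℂ) :=
  MvPolynomial.mkDerivation ℂ fun i => C ((i : ℕ) : ℂ) * X (i - 1)

/-- The derivation `F` with `F(x_i) = (ℓ−i)·x_{i+1}` (and `x_{ℓ+1} = 0`). -/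
noncomputable def Fderiv (ℓ : ℕ) :
    Derivation ℂ (MvPolynomial (Fin (ℓ + 1)) ℂ) (MvPolynomial (Fin (ℓ + 1)) ℂ) :=
  MvPolynomial.mkDerivation ℂ fun i => C ((ℓ : ℂ) - ((i : ℕ) : ℂ)) * X (i + 1)

/-- The derivation `H` with `H(x_i) = (ℓ−2i)·x_i`. -/
noncomputable def Hderiv (ℓ : ℕ) :
    Derivation ℂ (MvPolynomial (Fin (ℓ + 1)) ℂ) (MvPolynomial (Fin (ℓ + 1)) ℂ) :=
  MvPolynomial.mkDerivation ℂ fun i => C ((ℓ : ℂ) - 2 * ((i : ℕ) : ℂ)) * X i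

/-- `P_{abc}`, the image of `x_a ∧ x_b ∧ x_c` under the Jacobian map `E ∧ F ∧ H`. -/
noncomputable def Pabc (ℓ : ℕ) (a b c : Fin (ℓ + 1)) : MvPolynomial (Fin (ℓ + 1)) ℂ :=
  Matrix.det !![Ederiv ℓ (X a), Fderiv ℓ (X a), Hderiv ℓ (X a);
                Ederiv ℓ (X b), Fderiv ℓ (X b), Hderiv ℓ (X b);
                Ederiv ℓ (X c), Fderiv ℓ (X c), Hderiv ℓ (X c)]

/-- The Jacobian ideal `J`, generated by all `P_{abc}` with `a < b < c`. -/
noncomputable def Jideal (ℓ : ℕ) : Ideal (MvPolynomial (Fin (ℓ + 1)) ℂ) :=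
  Ideal.span {p | ∃ a b c : Fin (ℓ + 1), a < b ∧ b < c ∧ p = Pabc ℓ a b c}

/-- The moments of the Appell sequence `appellCurve`. -/
noncomputable def appellMoment (r j : ℕ) : ℝ := (Nat.choose (2 * j) j : ℝ) / Nat.choose r j

/-- The Appell sequence `Y_k = ∑_j a_j C(k, 2j) ε^j t^(k-2j)` in `ℂ[ε][t]`; modulo `ε^(r+1)` it
parametrizes the zero scheme of the Jacobian ideal on the chart `x_0 = 1`, with `ℓ = 2r + 1`. -/
noncomputable def appellCurve (r k : ℕ) : Polynomial (Polynomial ℂ) :=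
  ∑ j ∈ Finset.range (r + 1),
    Polynomial.C (Polynomial.C (appellMoment r j : ℂ) * Polynomial.X ^ j) *
    ((Nat.choose k (2 * j) : Polynomial (Polynomial ℂ)) * Polynomial.X ^ (k - 2 * j))

lemma appellMoment_pos {r j : ℕ} (h : j ≤ r) : 0 < appellMoment r j := by
  unfold appellMoment
  have h1 : 0 < Nat.choose r j := Nat.choose_pos h
  have h2 : 0 < Nat.choose (2 * j) j := Nat.choose_pos (by omega)
  positivity

lemma appellMoment_zero (r : ℕ) : appellMoment r 0 = 1 := by simp [appellMoment]

lemma appellMoment_succ {r j : ℕ} (h : j < r) :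
    appellMoment r (j + 1) * ((r : ℝ) - j) = 2 * (2 * j + 1) * appellMoment r j := by
  unfold appellMoment
  have h1 : (Nat.choose r j : ℝ) ≠ 0 := by exact_mod_cast (Nat.choose_pos h.le).ne'
  have h2 : (Nat.choose r (j + 1) : ℝ) ≠ 0 := by exact_mod_cast (Nat.choose_pos h).ne'
  have h3 : (Nat.choose r (j + 1) : ℝ) * (j + 1) = Nat.choose r j * ((r : ℝ) - j) := by
    rw [← Nat.cast_sub h.le]; exact_mod_cast Nat.choose_succ_right_eq r j
  have h4 : ((j : ℝ) + 1) * Nat.choose (2 * (j + 1)) (j + 1)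
      = 2 * (2 * j + 1) * Nat.choose (2 * j) j := by
    exact_mod_cast Nat.succ_mul_centralBinom_succ j
  have h5 : (j : ℝ) + 1 ≠ 0 := by positivity
  rw [div_mul_eq_mul_div, mul_div_assoc', div_eq_div_iff h2 h1]
  apply mul_left_cancel₀ h5
  linear_combination (Nat.choose r j : ℝ) * ((r : ℝ) - j) * h4
    - 2 * (2 * j + 1) * (Nat.choose (2 * j) j : ℝ) * h3

lemma derivative_appellCurve (r k : ℕ) :
    Polynomial.derivative (appellCurve r k) =
      (k : Polynomial (Polynomial ℂ)) * appellCurve r (k - 1) := by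
  unfold appellCurve
  rw [map_sum, Finset.mul_sum]
  refine Finset.sum_congr rfl fun j _ => ?_
  have h : (Nat.choose k (2 * j) : Polynomial (Polynomial ℂ)) *
        ((k - 2 * j : ℕ) : Polynomial (Polynomial ℂ))
      = k * (Nat.choose (k - 1) (2 * j) : Polynomial (Polynomial ℂ)) := by
    rcases k with _ | k
    · simp
    · have := Nat.choose_mul_succ_eq k (2 * j)
      norm_cast
      rw [← this, Nat.add_sub_cancel, mul_comm]
  rw [Polynomial.derivative_C_mul, Polynomial.derivative_natCast_mul, Polynomial.derivative_X_pow,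
    show k - 2 * j - 1 = k - 1 - 2 * j by omega, Polynomial.C_eq_natCast]
  linear_combination Polynomial.C (Polynomial.C (appellMoment r j : ℂ) * Polynomial.X ^ j) *
    Polynomial.X ^ (k - 1 - 2 * j) * h

lemma choose_mul_X_pow_succ {R : Type*} [CommSemiring R] (x : R) (k j : ℕ) :
    (Nat.choose k j : R) * (x * x ^ (k - j)) = Nat.choose k j * x ^ (k + 1 - j) := by
  rcases le_or_gt j k with h | h
  · rw [← pow_succ', Nat.sub_add_comm h]
  · simp [Nat.choose_eq_zero_of_lt h]

lemma choose_relation (l k j : ℕ) :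
    ((l : ℂ) - k) * Nat.choose (k + 1) (2 * (j + 1)) =
      (l - 2 * k) * Nat.choose k (2 * (j + 1)) + k * Nat.choose (k - 1) (2 * (j + 1))
        + (l - 1 - 2 * j) * Nat.choose k (2 * j + 1) := by
  have h1 : (Nat.choose (k + 1) (2 * (j + 1)) : ℂ) =
      Nat.choose k (2 * j + 1) + Nat.choose k (2 * (j + 1)) := by
    exact_mod_cast Nat.choose_succ_succ k (2 * j + 1)
  have h2 : (k : ℂ) * Nat.choose (k - 1) (2 * (j + 1)) =
      Nat.choose k (2 * (j + 1)) * ((k : ℂ) - 2 * (j + 1)) := by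
    rcases k with _ | k
    · simp [Nat.choose_eq_zero_of_lt (show 0 < 2 * (j + 1) by omega)]
    · rcases le_or_gt (2 * (j + 1)) (k + 1) with h | h
      · have := Nat.choose_mul_succ_eq k (2 * (j + 1))
        rw [mul_comm, Nat.add_sub_cancel]
        have h' : (((k + 1 - 2 * (j + 1) : ℕ)) : ℂ) = ((k + 1 : ℕ) : ℂ) - 2 * (j + 1) := by
          rw [Nat.cast_sub h]; push_cast; ring
        rw [← h']; exact_mod_cast this
      · simp [Nat.choose_eq_zero_of_lt h, Nat.choose_eq_zero_of_lt (show k < 2 * (j + 1) by omega)]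
  have h3 : (Nat.choose k (2 * (j + 1)) : ℂ) * (2 * (j + 1)) =
      Nat.choose k (2 * j + 1) * ((k : ℂ) - (2 * j + 1)) := by
    rcases le_or_gt (2 * j + 1) k with h | h
    · have := Nat.choose_succ_right_eq k (2 * j + 1)
      have h' : (((k - (2 * j + 1) : ℕ)) : ℂ) = (k : ℂ) - (2 * j + 1) := by
        rw [Nat.cast_sub h]; push_cast; ring
      rw [← h']; exact_mod_cast this
    · simp [Nat.choose_eq_zero_of_lt h, Nat.choose_eq_zero_of_lt (show k < 2 * (j + 1) by omega)]
  linear_combination ((l : ℂ) - k) * h1 - h2 + h3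

lemma mul_choose_pred (k j : ℕ) :
    (k : ℂ) * Nat.choose (k - 1) (2 * j) = (2 * j + 1) * Nat.choose k (2 * j + 1) := by
  rcases k with _ | k
  · simp
  · rw [Nat.add_sub_cancel, mul_comm (2 * (j : ℂ) + 1)]
    exact_mod_cast Nat.add_one_mul_choose_eq k (2 * j)

/-- Modulo `ε^(r+1)`, the curve is stabilized by the combination `F - tH - (t² + 4ε)E`. -/
lemma appellCurve_relation (r k : ℕ) : Polynomial.C (Polynomial.X ^ (r + 1)) ∣
    Polynomial.C (Polynomial.C (((2 * r + 1 : ℕ) : ℂ) - k)) * appellCurve r (k + 1)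
      - Polynomial.X *
        (Polynomial.C (Polynomial.C (((2 * r + 1 : ℕ) : ℂ) - 2 * k)) * appellCurve r k)
      - (Polynomial.X ^ 2 + 4 * Polynomial.C Polynomial.X) *
        (Polynomial.C (Polynomial.C (k : ℂ)) * appellCurve r (k - 1)) := by
  set ι : ℂ →+* Polynomial (Polynomial ℂ) := Polynomial.C.comp Polynomial.C with hι
  have hC : ∀ z : ℂ, Polynomial.C (Polynomial.C z) = ι z := fun z => rfl
  have hN : ∀ N : ℕ, (N : Polynomial (Polynomial ℂ)) = ι N := fun N => (map_natCast ι N).symm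
  set t : Polynomial (Polynomial ℂ) := Polynomial.X with ht
  set e : Polynomial (Polynomial ℂ) := Polynomial.C Polynomial.X with he
  let c : ℕ → Polynomial (Polynomial ℂ) := fun j => ι (appellMoment r j) * e ^ j
  have hY : ∀ k, appellCurve r k =
      ∑ j ∈ Finset.range (r + 1), c j * (ι (Nat.choose k (2 * j)) * t ^ (k - 2 * j)) := by
    intro k
    simp only [appellCurve, c, map_mul, map_pow, hC, hN, ← he, ← ht]
  let U : ℕ → Polynomial (Polynomial ℂ) := fun j =>
    c j * ((ι ((2 * r + 1 : ℕ) - k) * ι (Nat.choose (k + 1) (2 * j))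
      - ι ((2 * r + 1 : ℕ) - 2 * k) * ι (Nat.choose k (2 * j))
      - ι k * ι (Nat.choose (k - 1) (2 * j))) * t ^ (k + 1 - 2 * j))
  let V : ℕ → Polynomial (Polynomial ℂ) := fun j =>
    4 * e * (ι k * (c j * (ι (Nat.choose (k - 1) (2 * j)) * t ^ (k - 1 - 2 * j))))
  have h1 : ∀ j, ι (Nat.choose k j) * (t * t ^ (k - j)) = ι (Nat.choose k j) * t ^ (k + 1 - j) := by
    intro j; simpa only [hN] using choose_mul_X_pow_succ t k j
  have h2 : ∀ j, ι k * ι (Nat.choose (k - 1) j) * (t ^ 2 * t ^ (k - 1 - j))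
      = ι k * ι (Nat.choose (k - 1) j) * t ^ (k + 1 - j) := by
    intro j
    rcases k with _ | k
    · simp
    · rcases le_or_gt j k with h | h
      · rw [← pow_add, Nat.add_sub_cancel, show 2 + (k - j) = k + 1 + 1 - j by omega]
      · simp [Nat.choose_eq_zero_of_lt h]
  have hUV : ι ((2 * r + 1 : ℕ) - k) * appellCurve r (k + 1)
      - t * (ι ((2 * r + 1 : ℕ) - 2 * k) * appellCurve r k)
      - (t ^ 2 + 4 * e) * (ι k * appellCurve r (k - 1))
      = ∑ j ∈ Finset.range (r + 1), U j - ∑ j ∈ Finset.range (r + 1), V j := by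
    simp only [hY, Finset.mul_sum]
    rw [← Finset.sum_sub_distrib, ← Finset.sum_sub_distrib, ← Finset.sum_sub_distrib]
    refine Finset.sum_congr rfl fun j _ => ?_
    simp only [U, V]
    linear_combination (-c j * ι ((2 * r + 1 : ℕ) - 2 * k)) * h1 (2 * j) - c j * h2 (2 * j)
  have hU0 : U 0 = 0 := by
    simp only [U, ← map_mul, ← map_sub]
    simp only [mul_zero, Nat.choose_zero_right, Nat.cast_one, mul_one]
    rw [show ((2 * r + 1 : ℕ) : ℂ) - k - ((2 * r + 1 : ℕ) - 2 * k) - k = 0 by ring]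
    simp
  have hsucc : ∀ j ∈ Finset.range r, U (j + 1) = V j := by
    intro j hj
    have ha : (appellMoment r (j + 1) : ℂ) * ((r : ℂ) - j) =
        2 * (2 * j + 1) * appellMoment r j := by
      exact_mod_cast congrArg (fun x : ℝ => (x : ℂ)) (appellMoment_succ (Finset.mem_range.1 hj))
    have hs : (appellMoment r (j + 1) : ℂ) *
        (((2 * r + 1 : ℕ) - k) * Nat.choose (k + 1) (2 * (j + 1))
        - ((2 * r + 1 : ℕ) - 2 * k) * Nat.choose k (2 * (j + 1))
        - k * Nat.choose (k - 1) (2 * (j + 1)))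
        = 4 * (k * (appellMoment r j * Nat.choose (k - 1) (2 * j))) := by
      have h3 := choose_relation (2 * r + 1) k j
      have h4 := mul_choose_pred k j
      push_cast at h3 ⊢
      linear_combination (appellMoment r (j + 1) : ℂ) * h3 - 4 * (appellMoment r j : ℂ) * h4
        + 2 * (Nat.choose k (2 * j + 1) : ℂ) * ha
    have hs' := congrArg ι hs
    simp only [map_mul, map_sub ι (_ * _), map_sub ι (_ - _), map_ofNat] at hs'
    simp only [U, V, c]
    rw [show k + 1 - 2 * (j + 1) = k - 1 - 2 * j by omega, pow_succ]
    linear_combination e ^ j * e * t ^ (k - 1 - 2 * j) * hs'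
  rw [hC, hC, hC, hUV, Finset.sum_range_succ', Finset.sum_range_succ V, hU0,
    Finset.sum_congr rfl hsucc]
  refine ⟨-(4 * (ι k * (ι (appellMoment r r) *
    (ι (Nat.choose (k - 1) (2 * r)) * t ^ (k - 1 - 2 * r))))), ?_⟩
  simp only [V, c, map_pow, ← he]
  ring

lemma Ederiv_X (ℓ : ℕ) (i : Fin (ℓ + 1)) : Ederiv ℓ (X i) = C ((i : ℕ) : ℂ) * X (i - 1) :=
  mkDerivation_X _ _ _

lemma Fderiv_X (ℓ : ℕ) (i : Fin (ℓ + 1)) :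
    Fderiv ℓ (X i) = C ((ℓ : ℂ) - ((i : ℕ) : ℂ)) * X (i + 1) :=
  mkDerivation_X _ _ _

lemma Hderiv_X (ℓ : ℕ) (i : Fin (ℓ + 1)) :
    Hderiv ℓ (X i) = C ((ℓ : ℂ) - 2 * ((i : ℕ) : ℂ)) * X i :=
  mkDerivation_X _ _ _

lemma Fin.val_sub_one_of_pos {ℓ : ℕ} {i : Fin (ℓ + 1)} (h : 0 < (i : ℕ)) :
    ((i - 1 : Fin (ℓ + 1)) : ℕ) = (i : ℕ) - 1 :=
  Fin.val_sub_one_of_ne_zero fun h0 => by simp [h0] at h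

lemma Fin.val_add_one_of_val_lt {ℓ : ℕ} {i : Fin (ℓ + 1)} (h : (i : ℕ) < ℓ) :
    ((i + 1 : Fin (ℓ + 1)) : ℕ) = (i : ℕ) + 1 :=
  Fin.val_add_one_of_lt (Fin.lt_def.2 (by simpa using h))

/-- Restriction of polynomial functions to the curve `appellCurve`. -/
noncomputable def restrictCurve (r : ℕ) :
    MvPolynomial (Fin (2 * r + 1 + 1)) ℂ →ₐ[ℂ] Polynomial (Polynomial ℂ) :=
  aeval fun i => appellCurve r i

lemma restrictCurve_X (r : ℕ) (i : Fin (2 * r + 1 + 1)) :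
    restrictCurve r (X i) = appellCurve r i := aeval_X _ _

lemma restrictCurve_C (r : ℕ) (z : ℂ) :
    restrictCurve r (C z) = Polynomial.C (Polynomial.C z) := by
  simp [restrictCurve, Polynomial.algebraMap_apply]

lemma restrictCurve_Ederiv_X (r : ℕ) (i : Fin (2 * r + 1 + 1)) :
    restrictCurve r (Ederiv (2 * r + 1) (X i)) =
      Polynomial.C (Polynomial.C ((i : ℕ) : ℂ)) * appellCurve r (i - 1) := by
  rw [Ederiv_X, map_mul, restrictCurve_C, restrictCurve_X]
  rcases Nat.eq_zero_or_pos (i : ℕ) with h | h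
  · simp [h]
  · rw [Fin.val_sub_one_of_pos h]

lemma restrictCurve_Fderiv_X (r : ℕ) (i : Fin (2 * r + 1 + 1)) :
    restrictCurve r (Fderiv (2 * r + 1) (X i)) =
      Polynomial.C (Polynomial.C (((2 * r + 1 : ℕ) : ℂ) - ((i : ℕ) : ℂ))) *
        appellCurve r (i + 1) := by
  rw [Fderiv_X, map_mul, restrictCurve_C, restrictCurve_X]
  rcases Nat.lt_or_ge (i : ℕ) (2 * r + 1) with h | h
  · rw [Fin.val_add_one_of_val_lt h]
  · rw [show (i : ℕ) = 2 * r + 1 by omega]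
    simp

lemma restrictCurve_Hderiv_X (r : ℕ) (i : Fin (2 * r + 1 + 1)) :
    restrictCurve r (Hderiv (2 * r + 1) (X i)) =
      Polynomial.C (Polynomial.C (((2 * r + 1 : ℕ) : ℂ) - 2 * ((i : ℕ) : ℂ))) *
        appellCurve r i := by
  rw [Hderiv_X, map_mul, restrictCurve_C, restrictCurve_X]

lemma restrictCurve_relation_X (r : ℕ) (i : Fin (2 * r + 1 + 1)) :
    Polynomial.C (Polynomial.X ^ (r + 1)) ∣ restrictCurve r (Fderiv (2 * r + 1) (X i))
      - Polynomial.X * restrictCurve r (Hderiv (2 * r + 1) (X i))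
      - (Polynomial.X ^ 2 + 4 * Polynomial.C Polynomial.X) *
        restrictCurve r (Ederiv (2 * r + 1) (X i)) := by
  rw [restrictCurve_Ederiv_X, restrictCurve_Fderiv_X, restrictCurve_Hderiv_X]
  exact appellCurve_relation r i

lemma restrictCurve_Ederiv (r : ℕ) (f : MvPolynomial (Fin (2 * r + 1 + 1)) ℂ) :
    restrictCurve r (Ederiv (2 * r + 1) f) = Polynomial.derivative (restrictCurve r f) := by
  induction f using MvPolynomial.induction_on with
  | C a => simp [derivation_C]
  | add p q hp hq => simp only [map_add, hp, hq]
  | mul_X p i hp =>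
    have hX : restrictCurve r (Ederiv (2 * r + 1) (X i)) =
        Polynomial.derivative (restrictCurve r (X i)) := by
      rw [restrictCurve_Ederiv_X, restrictCurve_X, derivative_appellCurve]
      simp
    rw [Derivation.leibniz, smul_eq_mul, smul_eq_mul, map_add, map_mul, map_mul, map_mul,
      Polynomial.derivative_mul, hp, hX]
    ring

lemma restrictCurve_relation (r : ℕ) (f : MvPolynomial (Fin (2 * r + 1 + 1)) ℂ) :
    Polynomial.C (Polynomial.X ^ (r + 1)) ∣ restrictCurve r (Fderiv (2 * r + 1) f)
      - Polynomial.X * restrictCurve r (Hderiv (2 * r + 1) f)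
      - (Polynomial.X ^ 2 + 4 * Polynomial.C Polynomial.X) *
        restrictCurve r (Ederiv (2 * r + 1) f) := by
  induction f using MvPolynomial.induction_on with
  | C a => simp [derivation_C]
  | add p q hp hq =>
    simp only [map_add]
    obtain ⟨u, hu⟩ := hp
    obtain ⟨v, hv⟩ := hq
    exact ⟨u + v, by linear_combination hu + hv⟩
  | mul_X p i hp =>
    obtain ⟨u, hu⟩ := hp
    obtain ⟨v, hv⟩ := restrictCurve_relation_X r i
    refine ⟨restrictCurve r p * v + restrictCurve r (X i) * u, ?_⟩
    simp only [Derivation.leibniz, smul_eq_mul, map_add, map_mul]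
    linear_combination restrictCurve r p * hv + restrictCurve r (X i) * hu

lemma restrictCurve_of_mem_Jideal {r : ℕ} {f : MvPolynomial (Fin (2 * r + 1 + 1)) ℂ}
    (hf : f ∈ Jideal (2 * r + 1)) :
    Polynomial.C (Polynomial.X ^ (r + 1)) ∣ restrictCurve r f := by
  rw [← Ideal.mem_span_singleton]
  suffices h : Jideal (2 * r + 1) ≤
      (Ideal.span {Polynomial.C (Polynomial.X ^ (r + 1))}).comap (restrictCurve r) from h hf
  refine Ideal.span_le.2 ?_
  rintro _ ⟨a, b, c, -, -, rfl⟩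
  rw [SetLike.mem_coe, Ideal.mem_comap, Ideal.mem_span_singleton, Pabc, Matrix.det_fin_three]
  obtain ⟨u, hu⟩ := restrictCurve_relation_X r a
  obtain ⟨v, hv⟩ := restrictCurve_relation_X r b
  obtain ⟨w, hw⟩ := restrictCurve_relation_X r c
  simp only [Matrix.of_apply, Matrix.cons_val', Matrix.cons_val_zero, Matrix.cons_val_one,
    Matrix.cons_val, map_add, map_sub, map_mul]
  generalize restrictCurve r (Ederiv (2 * r + 1) (X a)) = Ea at *
  generalize restrictCurve r (Ederiv (2 * r + 1) (X b)) = Eb at *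
  generalize restrictCurve r (Ederiv (2 * r + 1) (X c)) = Ec at *
  generalize restrictCurve r (Hderiv (2 * r + 1) (X a)) = Ha at *
  generalize restrictCurve r (Hderiv (2 * r + 1) (X b)) = Hb at *
  generalize restrictCurve r (Hderiv (2 * r + 1) (X c)) = Hc at *
  refine ⟨u * (Hb * Ec - Eb * Hc) + v * (Ea * Hc - Ha * Ec) + w * (Ha * Eb - Ea * Hb), ?_⟩
  linear_combination (Hb * Ec - Eb * Hc) * hu + (Ea * Hc - Ha * Ec) * hv
    + (Ha * Eb - Ea * Hb) * hw

lemma derivation_C_mul_eq {σ : Type*}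
    (D : Derivation ℂ (MvPolynomial σ ℂ) (MvPolynomial σ ℂ)) (a : ℂ) (f : MvPolynomial σ ℂ) :
    D (C a * f) = C a * D f := by
  rw [Derivation.leibniz, derivation_C, smul_zero, add_zero, smul_eq_mul]

lemma derivation_isHomogeneous {ℓ n : ℕ}
    (D : Derivation ℂ (MvPolynomial (Fin (ℓ + 1)) ℂ) (MvPolynomial (Fin (ℓ + 1)) ℂ))
    (hD : ∀ i, (D (X i)).IsHomogeneous 1) {f : MvPolynomial (Fin (ℓ + 1)) ℂ}
    (hf : f.IsHomogeneous n) : (D f).IsHomogeneous n := by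
  induction n generalizing f with
  | zero =>
    rw [← totalDegree_zero_iff_isHomogeneous, totalDegree_eq_zero_iff_eq_C] at hf
    rw [hf, derivation_C]
    exact isHomogeneous_zero _ _ _
  | succ n ih =>
    have hf' : f ∈ homogeneousSubmodule (Fin (ℓ + 1)) ℂ n * Submodule.span ℂ (Set.range X) := by
      rw [← homogeneousSubmodule_one_eq_span_X,
        ← homogeneousSubmodule_one_pow (R := ℂ) (n := n), ← pow_succ,
        homogeneousSubmodule_one_pow]
      exact hf
    clear hf
    rw [← Submodule.span_eq (homogeneousSubmodule (Fin (ℓ + 1)) ℂ n),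
      Submodule.span_mul_span] at hf'
    induction hf' using Submodule.span_induction with
    | mem x hx =>
      obtain ⟨p, hp, _, ⟨i, rfl⟩, rfl⟩ := hx
      simp only [Derivation.leibniz, smul_eq_mul]
      refine (IsHomogeneous.mul hp (hD i)).add ?_
      rw [mul_comm]
      exact (ih hp).mul (isHomogeneous_X _ i)
    | zero => rw [map_zero]; exact isHomogeneous_zero _ _ _
    | add x y _ _ hx hy => rw [map_add]; exact hx.add hy
    | smul a x _ hx => rw [D.map_smul, smul_eq_C_mul]; exact hx.C_mul a

lemma Fderiv_isHomogeneous {ℓ n : ℕ} {f : MvPolynomial (Fin (ℓ + 1)) ℂ}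
    (hf : f.IsHomogeneous n) : (Fderiv ℓ f).IsHomogeneous n :=
  derivation_isHomogeneous _ (fun i => by rw [Fderiv_X]; exact isHomogeneous_C_mul_X _ _) hf

lemma Hderiv_Fderiv (ℓ : ℕ) (f : MvPolynomial (Fin (ℓ + 1)) ℂ) :
    Hderiv ℓ (Fderiv ℓ f) = Fderiv ℓ (Hderiv ℓ f) - C 2 * Fderiv ℓ f := by
  have h : ⁅Hderiv ℓ, Fderiv ℓ⁆ = (-2 : ℂ) • Fderiv ℓ := by
    refine derivation_ext fun i => ?_
    rw [Derivation.commutator_apply, Derivation.smul_apply, Fderiv_X, Hderiv_X, derivation_C_mul_eq,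
      derivation_C_mul_eq, Fderiv_X, Hderiv_X, smul_eq_C_mul]
    rcases Nat.lt_or_ge (i : ℕ) ℓ with h | h
    · rw [Fin.val_add_one_of_val_lt h]
      simp only [map_sub, map_mul, map_neg, Nat.cast_add, Nat.cast_one, map_add, map_one]
      ring
    · rw [show (i : ℕ) = ℓ by omega]
      simp
  have h' := congrArg (fun D => D f) h
  simp only [Derivation.commutator_apply, Derivation.smul_apply, smul_eq_C_mul, map_neg] at h'
  linear_combination h'

lemma appellCurve_coeff_zero_even {r s : ℕ} (hs : s ≤ r) :
    (appellCurve r (2 * s)).coeff 0 = Polynomial.C (appellMoment r s : ℂ) * Polynomial.X ^ s := by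
  unfold appellCurve
  rw [Polynomial.finsetSum_coeff, Finset.sum_eq_single_of_mem s (by simp; omega)]
  · rw [Polynomial.coeff_C_mul, Nat.sub_self, pow_zero, mul_one, Nat.choose_self, Nat.cast_one,
      Polynomial.coeff_one_zero, mul_one]
  · intro j _ hj
    rcases lt_or_gt_of_ne hj with h | h
    · rw [Polynomial.coeff_C_mul, Polynomial.mul_coeff_zero, Polynomial.coeff_X_pow,
        if_neg (by omega), mul_zero, mul_zero]
    · simp [Nat.choose_eq_zero_of_lt (show 2 * s < 2 * j by omega)]

lemma appellCurve_coeff_zero_odd (r s : ℕ) : (appellCurve r (2 * s + 1)).coeff 0 = 0 := by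
  unfold appellCurve
  rw [Polynomial.finsetSum_coeff]
  refine Finset.sum_eq_zero fun j _ => ?_
  rcases le_or_gt j s with h | h
  · rw [Polynomial.coeff_C_mul, Polynomial.mul_coeff_zero, Polynomial.coeff_X_pow,
      if_neg (by omega), mul_zero, mul_zero]
  · simp [Nat.choose_eq_zero_of_lt (show 2 * s + 1 < 2 * j by omega)]

lemma appellCurve_zero (r : ℕ) : appellCurve r 0 = 1 := by
  unfold appellCurve
  rw [Finset.sum_eq_single_of_mem 0 (by simp)]
  · simp [appellMoment_zero]
  · intro j _ hj
    simp [Nat.choose_eq_zero_of_lt (show 0 < 2 * j by omega)]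

/-- The `N`-th transvectant of an Appell sequence with itself is constant. -/
lemma derivative_transvectant {R : Type*} [CommRing R] (Y : ℕ → Polynomial R)
    (hY : ∀ k, Polynomial.derivative (Y k) = k * Y (k - 1)) (N : ℕ) :
    Polynomial.derivative
      (∑ k ∈ Finset.range (N + 1),
        (-1) ^ k * (N.choose k : Polynomial R) * (Y k * Y (N - k))) = 0 := by
  have hterm : ∀ k, Polynomial.derivative
      ((-1) ^ k * (N.choose k : Polynomial R) * (Y k * Y (N - k))) =
      (-1) ^ k * ((N.choose k * k : ℕ) : Polynomial R) * (Y (k - 1) * Y (N - k)) +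
      (-1) ^ k * ((N.choose k * (N - k) : ℕ) : Polynomial R) * (Y k * Y (N - k - 1)) := by
    intro k
    have h0 : Polynomial.derivative ((-1) ^ k * (N.choose k : Polynomial R)) = 0 := by
      have : (-1) ^ k * (N.choose k : Polynomial R) =
          Polynomial.C ((-1) ^ k * (N.choose k : R)) := by
        simp
      rw [this, Polynomial.derivative_C]
    rw [Polynomial.derivative_mul, h0, Polynomial.derivative_mul, hY, hY]
    push_cast
    ring
  simp only [map_sum, hterm, Finset.sum_add_distrib]
  rw [Finset.sum_range_succ', Finset.sum_range_succ (fun k => (-1) ^ k *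
    ((N.choose k * (N - k) : ℕ) : Polynomial R) * (Y k * Y (N - k - 1)))]
  simp only [Nat.sub_self, mul_zero, Nat.cast_zero, zero_mul, add_zero, Nat.add_sub_cancel]
  rw [← Finset.sum_add_distrib]
  refine Finset.sum_eq_zero fun k _ => ?_
  rw [Nat.choose_succ_right_eq, ← Nat.sub_sub]
  ring

/-- The highest weight vector `x_0^(n-2) q_i` of weight `nℓ - 4i`. -/
noncomputable def highestWeight (r n i : ℕ) : MvPolynomial (Fin (2 * r + 1 + 1)) ℂ :=
  X 0 ^ (n - 2) * ∑ k ∈ Finset.range (2 * i + 1), C ((-1) ^ k * ((2 * i).choose k : ℂ)) *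
    (X (Fin.ofNat (2 * r + 1 + 1) k) * X (Fin.ofNat (2 * r + 1 + 1) (2 * i - k)))

lemma highestWeight_isHomogeneous (r i : ℕ) {n : ℕ} (hn : 2 ≤ n) :
    (highestWeight r n i).IsHomogeneous n := by
  have h : (highestWeight r n i).IsHomogeneous ((n - 2) + 2) := by
    refine IsHomogeneous.mul (isHomogeneous_X_pow _ _) (IsHomogeneous.sum _ _ _ fun k _ => ?_)
    exact IsHomogeneous.C_mul ((isHomogeneous_X _ _).mul (isHomogeneous_X _ _)) _
  rwa [Nat.sub_add_cancel hn] at h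

lemma Hderiv_X_zero_pow (ℓ m : ℕ) :
    Hderiv ℓ (X 0 ^ m) = C ((m : ℂ) * ℓ) * X 0 ^ m := by
  induction m with
  | zero => simp
  | succ m ih =>
    rw [pow_succ, Derivation.leibniz, ih, Hderiv_X]
    simp only [smul_eq_mul, Fin.val_zero, Nat.cast_zero, mul_zero, sub_zero, map_mul, Nat.cast_add,
      Nat.cast_one, map_add, map_one]
    ring

lemma Hderiv_highestWeight {r n i : ℕ} (hn : 2 ≤ n) (hi : i ≤ r) :
    Hderiv (2 * r + 1) (highestWeight r n i) =
      C ((n : ℂ) * (2 * r + 1 : ℕ) - 4 * i) * highestWeight r n i := by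
  have hsum : Hderiv (2 * r + 1) (∑ k ∈ Finset.range (2 * i + 1),
      C ((-1) ^ k * ((2 * i).choose k : ℂ)) *
        (X (Fin.ofNat (2 * r + 1 + 1) k) * X (Fin.ofNat (2 * r + 1 + 1) (2 * i - k)))) =
      C (2 * (2 * r + 1 : ℕ) - 4 * i : ℂ) * ∑ k ∈ Finset.range (2 * i + 1),
        C ((-1) ^ k * ((2 * i).choose k : ℂ)) *
        (X (Fin.ofNat (2 * r + 1 + 1) k) * X (Fin.ofNat (2 * r + 1 + 1) (2 * i - k))) := by
    rw [map_sum, Finset.mul_sum]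
    refine Finset.sum_congr rfl fun k hk => ?_
    have hk' : k ≤ 2 * i := Nat.lt_succ_iff.1 (Finset.mem_range.1 hk)
    rw [derivation_C_mul_eq, Derivation.leibniz, Hderiv_X, Hderiv_X, Fin.val_ofNat, Fin.val_ofNat,
      Nat.mod_eq_of_lt (by omega), Nat.mod_eq_of_lt (by omega), Nat.cast_sub hk']
    simp only [smul_eq_mul, map_sub, map_mul, map_ofNat, Nat.cast_mul, Nat.cast_ofNat]
    ring
  unfold highestWeight
  rw [Derivation.leibniz, hsum, Hderiv_X_zero_pow, Nat.cast_sub hn]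
  simp only [smul_eq_mul, map_sub, map_mul, map_ofNat, Nat.cast_ofNat]
  ring

lemma coeff_zero_neg_one_pow_mul_natCast {R : Type*} [CommRing R] (s N : ℕ) :
    ((-1) ^ (2 * s) * (N : Polynomial R)).coeff 0 = N := by
  rw [(even_two_mul s).neg_one_pow, one_mul, Polynomial.coeff_natCast_ite, if_pos rfl]

lemma restrictCurve_highestWeight {r i : ℕ} (n : ℕ) (hi : i ≤ r) :
    ∃ c : ℂ, c ≠ 0 ∧ restrictCurve r (highestWeight r n i) =
      Polynomial.C (Polynomial.C c * Polynomial.X ^ i) := by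
  let d : ℕ → ℝ := fun k =>
    if Even k then
      ((2 * i).choose k : ℝ) * (appellMoment r (k / 2) * appellMoment r (i - k / 2))
    else 0
  set g := ∑ k ∈ Finset.range (2 * i + 1), (-1) ^ k *
    ((2 * i).choose k : Polynomial (Polynomial ℂ)) *
      (appellCurve r k * appellCurve r (2 * i - k)) with hg
  have h1 : restrictCurve r (highestWeight r n i) = g := by
    unfold highestWeight
    rw [map_mul, map_pow, restrictCurve_X, Fin.val_zero, appellCurve_zero, one_pow,
      one_mul, map_sum]
    refine Finset.sum_congr rfl fun k hk => ?_
    have hk' : k ≤ 2 * i := Nat.lt_succ_iff.1 (Finset.mem_range.1 hk)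
    rw [map_mul, map_mul (restrictCurve r) (X _), restrictCurve_X, restrictCurve_X,
      restrictCurve_C, Fin.val_ofNat, Fin.val_ofNat, Nat.mod_eq_of_lt (by omega),
      Nat.mod_eq_of_lt (by omega)]
    simp
  have h2 : g = Polynomial.C (g.coeff 0) :=
    Polynomial.eq_C_of_derivative_eq_zero
      (derivative_transvectant _ (derivative_appellCurve r) (2 * i))
  have h3 : g.coeff 0 =
      Polynomial.C ((∑ k ∈ Finset.range (2 * i + 1), d k : ℝ) : ℂ) * Polynomial.X ^ i := by
    rw [hg, Polynomial.finsetSum_coeff, Complex.ofReal_sum, map_sum, Finset.sum_mul]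
    refine Finset.sum_congr rfl fun k hk => ?_
    have hk' : k ≤ 2 * i := Nat.lt_succ_iff.1 (Finset.mem_range.1 hk)
    rw [Polynomial.mul_coeff_zero, Polynomial.mul_coeff_zero (appellCurve r k)]
    rcases Nat.even_or_odd' k with ⟨s, rfl | rfl⟩
    · rw [show 2 * i - 2 * s = 2 * (i - s) by omega, appellCurve_coeff_zero_even (by omega),
        appellCurve_coeff_zero_even (by omega)]
      have hs : s + (i - s) = i := by omega
      have hc : ((-1) ^ (2 * s) * ((2 * i).choose (2 * s) : Polynomial (Polynomial ℂ))).coeff 0 =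
          ((2 * i).choose (2 * s) : Polynomial ℂ) := coeff_zero_neg_one_pow_mul_natCast s _
      have hX : (Polynomial.X : Polynomial ℂ) ^ i = Polynomial.X ^ s * Polynomial.X ^ (i - s) := by
        rw [← pow_add, hs]
      simp only [d, if_pos (even_two_mul s), Nat.mul_div_cancel_left s two_pos, Complex.ofReal_mul,
        map_mul, hc, hX, Complex.ofReal_natCast, map_natCast]
      ring
    · rw [appellCurve_coeff_zero_odd]
      simp [d]
  have h4 : 0 < ∑ k ∈ Finset.range (2 * i + 1), d k := by
    refine Finset.sum_pos' (fun k hk => ?_) ⟨0, by simp, ?_⟩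
    · have hk' : k ≤ 2 * i := Nat.lt_succ_iff.1 (Finset.mem_range.1 hk)
      simp only [d]
      split_ifs
      · have h5 := appellMoment_pos (show k / 2 ≤ r by omega)
        have h6 := appellMoment_pos (show i - k / 2 ≤ r by omega)
        positivity
      · exact le_rfl
    · have h6 := appellMoment_pos hi
      simp [d, appellMoment_zero, h6]
  exact ⟨_, Complex.ofReal_ne_zero.2 h4.ne', by rw [h1, h2, h3]⟩

lemma iterate_Fderiv_highestWeight_isHomogeneous (r i k : ℕ) {n : ℕ} (hn : 2 ≤ n) :
    ((Fderiv (2 * r + 1))^[k] (highestWeight r n i)).IsHomogeneous n := by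
  induction k with
  | zero => exact highestWeight_isHomogeneous r i hn
  | succ k ih => rw [Function.iterate_succ_apply']; exact Fderiv_isHomogeneous ih

lemma Hderiv_iterate_Fderiv_highestWeight {r n i : ℕ} (hn : 2 ≤ n) (hi : i ≤ r) (k : ℕ) :
    Hderiv (2 * r + 1) ((Fderiv (2 * r + 1))^[k] (highestWeight r n i)) =
      C ((n : ℂ) * (2 * r + 1 : ℕ) - 4 * i - 2 * k) *
        (Fderiv (2 * r + 1))^[k] (highestWeight r n i) := by
  induction k with
  | zero => simpa using Hderiv_highestWeight hn hi
  | succ k ih =>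
    rw [Function.iterate_succ_apply', Hderiv_Fderiv, ih, derivation_C_mul_eq]
    simp only [Nat.cast_add, Nat.cast_one, map_sub, map_mul, map_add, map_one, map_ofNat]
    ring

/-- The leading term in `ε` of the descendants of a highest weight vector. -/
lemma restrictCurve_iterate_Fderiv {r n i : ℕ} (hn : 2 ≤ n) (hi : i ≤ r) (k : ℕ)
    (hk : k ≤ n * (2 * r + 1) - 4 * i) :
    ∃ c : ℂ, c ≠ 0 ∧ Polynomial.C (Polynomial.X ^ (i + 1)) ∣
      restrictCurve r ((Fderiv (2 * r + 1))^[k] (highestWeight r n i)) -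
        Polynomial.C (Polynomial.C c * Polynomial.X ^ i) * Polynomial.X ^ k := by
  induction k with
  | zero =>
    obtain ⟨c, hc, h⟩ := restrictCurve_highestWeight n hi
    exact ⟨c, hc, by simp [h]⟩
  | succ k ih =>
    obtain ⟨c, hc, u, hu⟩ := ih (by omega)
    obtain ⟨v, hv⟩ := restrictCurve_relation r ((Fderiv (2 * r + 1))^[k] (highestWeight r n i))
    rw [Hderiv_iterate_Fderiv_highestWeight hn hi, restrictCurve_Ederiv, map_mul, restrictCurve_C,
      ← Function.iterate_succ_apply' (Fderiv (2 * r + 1))] at hv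
    set G := restrictCurve r ((Fderiv (2 * r + 1))^[k] (highestWeight r n i))
    have hG : Polynomial.derivative G = Polynomial.C (Polynomial.C c * Polynomial.X ^ i) *
        ((k : Polynomial (Polynomial ℂ)) * Polynomial.X ^ (k - 1)) +
        Polynomial.C (Polynomial.X ^ (i + 1)) * Polynomial.derivative u := by
      rw [sub_eq_iff_eq_add.1 hu, Polynomial.derivative_add, Polynomial.derivative_C_mul,
        Polynomial.derivative_C_mul, Polynomial.derivative_X_pow, Polynomial.C_eq_natCast]
      ring
    have hle : 4 * i ≤ n * (2 * r + 1) := by nlinarith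
    have hw : ((n * (2 * r + 1) - 4 * i - k : ℕ) : ℂ) = (n : ℂ) * (2 * r + 1 : ℕ) - 4 * i - k := by
      rw [Nat.cast_sub (by omega), Nat.cast_sub hle]
      push_cast; ring
    refine ⟨((n * (2 * r + 1) - 4 * i - k : ℕ) : ℂ) * c,
      mul_ne_zero (Nat.cast_ne_zero.2 (by omega)) hc, ?_⟩
    obtain ⟨s, hs⟩ : (Polynomial.C (Polynomial.X ^ (i + 1)) : Polynomial (Polynomial ℂ)) ∣
        Polynomial.C (Polynomial.X ^ (r + 1)) :=
      map_dvd _ (pow_dvd_pow _ (by omega))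
    have hkt : (k : Polynomial (Polynomial ℂ)) * (Polynomial.X * Polynomial.X ^ (k - 1)) =
        (k : Polynomial (Polynomial ℂ)) * Polynomial.X ^ k := by
      rcases k with _ | k
      · simp
      · rw [← pow_succ', Nat.add_sub_cancel]
    rw [hw]
    refine ⟨s * v + Polynomial.X * (Polynomial.C (Polynomial.C
        ((n : ℂ) * (2 * r + 1 : ℕ) - 4 * i - 2 * k)) * u) +
        (Polynomial.X ^ 2 + 4 * Polynomial.C Polynomial.X) * Polynomial.derivative u
        + 4 * Polynomial.C (Polynomial.C c) *
          ((k : Polynomial (Polynomial ℂ)) * Polynomial.X ^ (k - 1)), ?_⟩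
    rw [hs, hG, sub_eq_iff_eq_add.1 hu] at hv
    simp only [map_mul, map_sub, map_pow, map_natCast, map_ofNat, pow_succ] at hv hkt ⊢
    linear_combination hv +
      Polynomial.C (Polynomial.C c) * Polynomial.C Polynomial.X ^ i * Polynomial.X * hkt

lemma coeff_coeff_of_C_X_pow_dvd {R : Type*} [CommSemiring R] {f : Polynomial (Polynomial R)}
    {m j : ℕ} (hf : Polynomial.C (Polynomial.X ^ m) ∣ f) (hj : j < m) (k : ℕ) :
    (f.coeff k).coeff j = 0 := by
  obtain ⟨u, rfl⟩ := hf
  rw [Polynomial.coeff_C_mul, Polynomial.coeff_X_pow_mul', if_neg (by omega)]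

/-- The descendants of the highest weight vectors are linearly independent modulo `J`. -/
lemma linearIndependent_descendants {r n : ℕ} (hn : 2 ≤ n) :
    LinearIndependent ℂ fun x : Σ i : Fin (r + 1), Fin (n * (2 * r + 1) + 1 - 4 * (i : ℕ)) =>
      (Ideal.Quotient.mkₐ ℂ (Jideal (2 * r + 1))).toLinearMap
        ((Fderiv (2 * r + 1))^[(x.2 : ℕ)] (highestWeight r n x.1)) := by
  rw [Fintype.linearIndependent_iff]
  intro g hg
  have hmem : ∑ x : Σ i : Fin (r + 1), Fin (n * (2 * r + 1) + 1 - 4 * (i : ℕ)),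
      g x • (Fderiv (2 * r + 1))^[(x.2 : ℕ)] (highestWeight r n x.1) ∈ Jideal (2 * r + 1) := by
    rw [← Ideal.Quotient.eq_zero_iff_mem, ← hg]
    simp only [← map_smul, ← map_sum]
    rfl
  have hdvd := restrictCurve_of_mem_Jideal hmem
  rw [map_sum] at hdvd
  have hlead : ∀ x : Σ i : Fin (r + 1), Fin (n * (2 * r + 1) + 1 - 4 * (i : ℕ)),
      ∃ c : ℂ, c ≠ 0 ∧ Polynomial.C (Polynomial.X ^ ((x.1 : ℕ) + 1)) ∣
        restrictCurve r ((Fderiv (2 * r + 1))^[(x.2 : ℕ)] (highestWeight r n x.1)) -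
          Polynomial.C (Polynomial.C c * Polynomial.X ^ (x.1 : ℕ)) * Polynomial.X ^ (x.2 : ℕ) :=
    fun x => restrictCurve_iterate_Fderiv hn (by omega) _ (by have := x.2.isLt; omega)
  choose c hc hcd using hlead
  have main : ∀ m : ℕ, ∀ x : Σ i : Fin (r + 1), Fin (n * (2 * r + 1) + 1 - 4 * (i : ℕ)),
      (x.1 : ℕ) = m → g x = 0 := by
    intro m
    induction m using Nat.strong_induction_on with
    | _ m ih =>
      intro x hx
      subst hx
      have h0 := coeff_coeff_of_C_X_pow_dvd hdvd x.1.isLt x.2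
      rw [Polynomial.finsetSum_coeff, Polynomial.finsetSum_coeff, Finset.sum_eq_single x] at h0
      · have h1 := coeff_coeff_of_C_X_pow_dvd (hcd x) (Nat.lt_succ_self _) x.2
        rw [Polynomial.coeff_sub, Polynomial.coeff_sub, sub_eq_zero] at h1
        rw [map_smul, Polynomial.coeff_smul, Polynomial.coeff_smul, h1] at h0
        rw [Polynomial.coeff_C_mul, Polynomial.coeff_X_pow_self, mul_one, Polynomial.coeff_C_mul,
          Polynomial.coeff_X_pow_self, mul_one, smul_eq_mul] at h0
        exact (mul_eq_zero.1 h0).resolve_right (hc x)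
      · intro y _ hyx
        rw [map_smul, Polynomial.coeff_smul, Polynomial.coeff_smul]
        rcases lt_trichotomy (y.1 : ℕ) x.1 with h | h | h
        · rw [ih _ h y rfl, zero_smul]
        · have h1 := coeff_coeff_of_C_X_pow_dvd (hcd y) (show (x.1 : ℕ) < y.1 + 1 by omega) x.2
          rw [Polynomial.coeff_sub, Polynomial.coeff_sub, sub_eq_zero] at h1
          have hne : (x.2 : ℕ) ≠ y.2 := by
            intro h2
            obtain ⟨i, k⟩ := x
            obtain ⟨i', k'⟩ := y
            obtain rfl : i' = i := Fin.ext h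
            have hk : k' = k := Fin.ext h2.symm
            exact hyx (by rw [hk])
          rw [h1, Polynomial.coeff_C_mul, Polynomial.coeff_X_pow, if_neg hne, mul_zero,
            Polynomial.coeff_zero, smul_zero]
        · have hle : (Polynomial.C (Polynomial.X ^ (y.1 : ℕ)) : Polynomial (Polynomial ℂ)) ∣
              restrictCurve r ((Fderiv (2 * r + 1))^[(y.2 : ℕ)] (highestWeight r n y.1)) := by
            refine (dvd_sub_left ?_).1
              ((map_dvd Polynomial.C (pow_dvd_pow _ (Nat.le_succ _))).trans (hcd y))
            exact Dvd.dvd.mul_right (map_dvd Polynomial.C (dvd_mul_left _ _)) _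
          rw [coeff_coeff_of_C_X_pow_dvd hle h, smul_zero]
      · simp
  exact fun x => main _ x rfl

lemma sum_le_finrank {r n : ℕ} (hn : 2 ≤ n) :
    ∑ i ∈ Finset.range (r + 1), (n * (2 * r + 1) + 1 - 4 * i) ≤
      Module.finrank ℂ (Submodule.map (Ideal.Quotient.mkₐ ℂ (Jideal (2 * r + 1))).toLinearMap
          (homogeneousSubmodule (Fin (2 * r + 1 + 1)) ℂ n)) := by
  have : Module.Finite ℂ (homogeneousSubmodule (Fin (2 * r + 1 + 1)) ℂ n) :=
    Module.Finite.iff_fg.2 (homogeneousSubmodule_fg _ _ n)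
  let v : (Σ i : Fin (r + 1), Fin (n * (2 * r + 1) + 1 - 4 * (i : ℕ))) →
      Submodule.map (Ideal.Quotient.mkₐ ℂ (Jideal (2 * r + 1))).toLinearMap
          (homogeneousSubmodule (Fin (2 * r + 1 + 1)) ℂ n) := fun x =>
    ⟨_, Submodule.mem_map_of_mem (iterate_Fderiv_highestWeight_isHomogeneous r x.1 x.2 hn)⟩
  have hv : LinearIndependent ℂ v :=
    LinearIndependent.of_comp (Submodule.subtype _) (linearIndependent_descendants hn)
  have h := hv.fintype_card_le_finrank
  rw [Fintype.card_sigma] at h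
  simpa only [Fintype.card_fin, Finset.sum_range] using h

/-- Straightening a product of three variables modulo the ideal `J`. -/
lemma straighten_of_le {ℓ : ℕ} (hodd : Odd ℓ) {W : Submodule ℂ (MvPolynomial (Fin (ℓ + 1)) ℂ)}
    (hJ : ∀ p ∈ Jideal ℓ, p ∈ W) (M : MvPolynomial (Fin (ℓ + 1)) ℂ) {i j k : Fin (ℓ + 1)}
    (hi : 0 < (i : ℕ)) (hij : (i : ℕ) ≤ j) (hjk : (j : ℕ) ≤ k) (hk : (k : ℕ) < ℓ)
    (h : ∀ x y z : Fin (ℓ + 1), (i : ℕ) ^ 2 + (j : ℕ) ^ 2 + (k : ℕ) ^ 2 <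
      (x : ℕ) ^ 2 + (y : ℕ) ^ 2 + (z : ℕ) ^ 2 → X x * X y * X z * M ∈ W) :
    X i * X j * X k * M ∈ W := by
  have hterm : ∀ x y z : Fin (ℓ + 1), (i : ℤ) ^ 2 + (j : ℤ) ^ 2 + (k : ℤ) ^ 2 <
      ((x : ℕ) - 1 : ℤ) ^ 2 + ((y : ℕ) + 1 : ℤ) ^ 2 + (z : ℕ) ^ 2 →
      Ederiv ℓ (X x) * Fderiv ℓ (X y) * Hderiv ℓ (X z) * M ∈ W := by
    intro x y z hxyz
    rw [Ederiv_X, Fderiv_X, Hderiv_X]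
    rcases Nat.eq_zero_or_pos (x : ℕ) with hx | hx
    · simp [hx]
    rcases Nat.lt_or_ge (y : ℕ) ℓ with hy | hy
    · have hmem := W.smul_mem (((x : ℕ) : ℂ) * ((ℓ : ℂ) - (y : ℕ)) * ((ℓ : ℂ) - 2 * (z : ℕ)))
        (h (x - 1) (y + 1) z (by
          rw [Fin.val_sub_one_of_pos hx, Fin.val_add_one_of_val_lt hy]
          zify [hx]
          exact hxyz))
      rw [smul_eq_C_mul] at hmem
      convert hmem using 1
      simp only [map_mul]
      ring
    · simp [show (y : ℕ) = ℓ by omega]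
  set a : Fin (ℓ + 1) := i - 1 with ha
  set c : Fin (ℓ + 1) := k + 1 with hc
  have hav : (a : ℕ) = i - 1 := Fin.val_sub_one_of_pos hi
  have hcv : (c : ℕ) = k + 1 := Fin.val_add_one_of_val_lt hk
  have hai : a + 1 = i := by rw [ha, sub_add_cancel]
  have hck : c - 1 = k := by rw [hc, add_sub_cancel_right]
  have hP : Pabc ℓ a j c * M ∈ W := by
    refine hJ _ (Ideal.mul_mem_right _ _ (Ideal.subset_span ⟨a, j, c, ?_, ?_, rfl⟩)) <;>
      rw [Fin.lt_def] <;> omega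
  have haz : (a : ℤ) = i - 1 := by omega
  have hcz : (c : ℤ) = k + 1 := by omega
  have hijz : (i : ℤ) ≤ j := by omega
  have hjkz : (j : ℤ) ≤ k := by omega
  have h1 := hterm a j c (by rw [haz, hcz]; nlinarith)
  have h2 := hterm a c j (by rw [haz, hcz]; nlinarith)
  have h3 := hterm j a c (by rw [haz, hcz]; nlinarith)
  have h4 := hterm j c a (by rw [haz, hcz]; nlinarith)
  have h5 := hterm c j a (by rw [haz, hcz]; nlinarith)
  have hmain : Ederiv ℓ (X c) * Fderiv ℓ (X a) * Hderiv ℓ (X j) * M ∈ W := by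
    have hsum := W.add_mem (W.add_mem (W.add_mem (W.sub_mem (W.sub_mem hP h1) h4) h2) h5) h3
    convert hsum using 1
    rw [Pabc, Matrix.det_fin_three]
    simp only [Matrix.of_apply, Matrix.cons_val', Matrix.cons_val_zero, Matrix.cons_val_one,
      Matrix.cons_val]
    ring
  have hcoef : ((c : ℕ) : ℂ) * ((ℓ : ℂ) - (a : ℕ)) * ((ℓ : ℂ) - 2 * (j : ℕ)) ≠ 0 := by
    refine mul_ne_zero (mul_ne_zero (Nat.cast_ne_zero.2 (by omega)) (sub_ne_zero.2 ?_))
      (sub_ne_zero.2 ?_)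
    · exact Nat.cast_injective.ne (by omega)
    · obtain ⟨r, hr⟩ := hodd
      exact_mod_cast (show ℓ ≠ 2 * (j : ℕ) by omega)
  refine (W.smul_mem_iff hcoef).1 ?_
  rw [smul_eq_C_mul]
  convert hmain using 1
  rw [Ederiv_X, Fderiv_X, Hderiv_X, hai, hck]
  simp only [map_mul]
  ring

lemma straighten {ℓ : ℕ} (hodd : Odd ℓ) {W : Submodule ℂ (MvPolynomial (Fin (ℓ + 1)) ℂ)}
    (hJ : ∀ p ∈ Jideal ℓ, p ∈ W) (M : MvPolynomial (Fin (ℓ + 1)) ℂ) {i j k : Fin (ℓ + 1)}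
    (hi : i ∈ Finset.Ioo 0 (Fin.last ℓ)) (hj : j ∈ Finset.Ioo 0 (Fin.last ℓ))
    (hk : k ∈ Finset.Ioo 0 (Fin.last ℓ))
    (h : ∀ x y z : Fin (ℓ + 1), (i : ℕ) ^ 2 + (j : ℕ) ^ 2 + (k : ℕ) ^ 2 <
      (x : ℕ) ^ 2 + (y : ℕ) ^ 2 + (z : ℕ) ^ 2 → X x * X y * X z * M ∈ W) :
    X i * X j * X k * M ∈ W := by
  simp only [Finset.mem_Ioo, Fin.lt_def, Fin.val_zero, Fin.val_last] at hi hj hk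
  have key : ∀ {i' j' k' : Fin (ℓ + 1)}, 0 < (i' : ℕ) → (i' : ℕ) ≤ j' → (j' : ℕ) ≤ k' →
      (k' : ℕ) < ℓ → (i' : ℕ) ^ 2 + (j' : ℕ) ^ 2 + (k' : ℕ) ^ 2 =
        (i : ℕ) ^ 2 + (j : ℕ) ^ 2 + (k : ℕ) ^ 2 → X i' * X j' * X k' * M ∈ W :=
    fun h1 h2 h3 h4 he => straighten_of_le hodd hJ M h1 h2 h3 h4 fun x y z hx =>
      h x y z (he ▸ hx)
  rcases le_total (i : ℕ) j with h1 | h1 <;> rcases le_total (j : ℕ) k with h2 | h2 <;>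
    rcases le_total (i : ℕ) k with h3 | h3
  · exact key hi.1 h1 h2 hk.2 rfl
  · exact key hi.1 h1 h2 hk.2 rfl
  · convert key hi.1 h3 h2 hj.2 (by ring) using 1; ring
  · convert key hk.1 h3 h1 hj.2 (by ring) using 1; ring
  · convert key hj.1 h1 h3 hk.2 (by ring) using 1; ring
  · convert key hj.1 h2 h3 hi.2 (by ring) using 1; ring
  · convert key hk.1 h2 h1 hi.2 (by ring) using 1; ring
  · convert key hk.1 h2 h1 hi.2 (by ring) using 1; ring

/-- The index type of the monomials of degree `n` in which at most two of the variables
`x_1, …, x_{ℓ-1}` occur, counted with multiplicity. -/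
abbrev NormalIndex (ℓ n : ℕ) : Type :=
  Σ d : Fin 3, Sym (Finset.Ioo (0 : Fin (ℓ + 1)) (Fin.last ℓ)) d × Fin (n - d + 1)

/-- The monomials in which at most two of the variables `x_1, …, x_{ℓ-1}` occur. -/
noncomputable def normalMonomial (ℓ n : ℕ) (u : NormalIndex ℓ n) : MvPolynomial (Fin (ℓ + 1)) ℂ :=
  ((u.2.1 : Multiset (Finset.Ioo (0 : Fin (ℓ + 1)) (Fin.last ℓ))).map fun i => X i.1).prod *
    (X 0 ^ (u.2.2 : ℕ) * X (Fin.last ℓ) ^ (n - u.1 - u.2.2))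

lemma card_normalIndex {ℓ n : ℕ} (hℓ : 1 ≤ ℓ) (hn : 2 ≤ n) :
    Fintype.card (NormalIndex ℓ n) =
      Nat.choose (ℓ + 2) 2 + (n - 2) * Nat.choose (ℓ + 1) 2 := by
  obtain ⟨k, rfl⟩ := Nat.exists_eq_add_of_le' hℓ
  obtain ⟨m, rfl⟩ := Nat.exists_eq_add_of_le' hn
  have h1 : (k + 1 + 1).choose 2 = (k + 1).choose 2 + (k + 1) := by
    rw [Nat.choose_succ_succ' (k + 1) 1, Nat.choose_one_right, add_comm]
  have h2 : (k + 1 + 2).choose 2 = (k + 1).choose 2 + (k + 1) + (k + 2) := by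
    rw [Nat.choose_succ_succ' (k + 2) 1, Nat.choose_one_right, h1, add_comm]
  have h3 : Fintype.card (Finset.Ioo (0 : Fin (k + 1 + 1)) (Fin.last (k + 1))) = k := by
    rw [Fintype.card_coe, Fin.card_Ioo]
    simp
  rw [Fintype.card_sigma, h2, h1, Fin.sum_univ_three]
  simp only [Fintype.card_prod, Fintype.card_fin, Sym.card_sym_eq_multichoose, h3]
  rw [Fin.val_zero, Fin.val_one, Fin.val_two, Nat.multichoose_zero_right,
    Nat.multichoose_one_right, Nat.multichoose_eq, Nat.add_sub_cancel, Nat.sub_zero,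
    show k + 2 - 1 = k + 1 by omega, show m + 2 - 1 + 1 = m + 2 by omega]
  ring

lemma exists_prod_eq_pow_mul_pow {α R : Type*} [CommMonoid R] (f : α → R) {a b : α}
    (s : Multiset α) (hs : ∀ x ∈ s, x = a ∨ x = b) :
    ∃ e ≤ s.card, (s.map f).prod = f a ^ e * f b ^ (s.card - e) := by
  induction s using Multiset.induction_on with
  | empty => exact ⟨0, by simp⟩
  | cons x s ih =>
    obtain ⟨e, he, h⟩ := ih fun y hy => hs y (Multiset.mem_cons_of_mem hy)
    rw [Multiset.map_cons, Multiset.prod_cons, h, Multiset.card_cons]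
    rcases hs x (Multiset.mem_cons_self x s) with rfl | rfl
    · exact ⟨e + 1, by omega, by rw [Nat.add_sub_add_right, pow_succ', mul_assoc]⟩
    · exact ⟨e, by omega, by rw [Nat.sub_add_comm he, pow_succ', mul_left_comm]⟩

lemma prod_mem_range_normalMonomial {ℓ n : ℕ} {s : Multiset (Fin (ℓ + 1))} (hs : s.card = n)
    (h : (s.filter (· ∈ Finset.Ioo (0 : Fin (ℓ + 1)) (Fin.last ℓ))).card < 3) :
    (s.map X).prod ∈ Set.range (normalMonomial ℓ n) := by
  have hsplit := Multiset.filter_add_not (· ∈ Finset.Ioo (0 : Fin (ℓ + 1)) (Fin.last ℓ)) s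
  obtain ⟨e, he, hprod⟩ := exists_prod_eq_pow_mul_pow
    (X : Fin (ℓ + 1) → MvPolynomial (Fin (ℓ + 1)) ℂ) (a := 0) (b := Fin.last ℓ)
    (s.filter (¬ · ∈ Finset.Ioo (0 : Fin (ℓ + 1)) (Fin.last ℓ))) (by
      intro x hx
      have h1 := (Multiset.mem_filter.1 hx).2
      simp only [Finset.mem_Ioo, Fin.lt_def, Fin.val_zero, Fin.val_last] at h1
      rw [Fin.ext_iff, Fin.ext_iff, Fin.val_zero, Fin.val_last]
      omega)
  have hcard := congrArg Multiset.card hsplit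
  rw [Multiset.card_add, hs] at hcard
  obtain ⟨t, ht⟩ : ∃ t : Multiset (Finset.Ioo (0 : Fin (ℓ + 1)) (Fin.last ℓ)),
      t.map Subtype.val = s.filter (· ∈ Finset.Ioo (0 : Fin (ℓ + 1)) (Fin.last ℓ)) :=
    CanLift.prf _ fun x hx => (Multiset.mem_filter.1 hx).2
  rw [← ht, Multiset.card_map] at hcard h
  refine ⟨⟨⟨t.card, h⟩, ⟨t, rfl⟩, ⟨e, by simp only; omega⟩⟩, ?_⟩
  have hval : (s.map X).prod = (t.map fun i => (X i.1 : MvPolynomial (Fin (ℓ + 1)) ℂ)).prod *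
      (X 0 ^ e * X (Fin.last ℓ) ^ (n - t.card - e)) := by
    rw [show n - t.card = (s.filter
      (¬ · ∈ Finset.Ioo (0 : Fin (ℓ + 1)) (Fin.last ℓ))).card by omega, ← hprod,
      show t.map (fun i => (X i.1 : MvPolynomial (Fin (ℓ + 1)) ℂ)) = (t.map Subtype.val).map X from
        (Multiset.map_map X Subtype.val t).symm, ht,
      ← Multiset.prod_add, ← Multiset.map_add, hsplit]
  exact hval.symm

lemma prod_mem_sup {ℓ : ℕ} (n : ℕ) (hodd : Odd ℓ) (s : Multiset (Fin (ℓ + 1))) (hs : s.card = n) :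
    (s.map X).prod ∈ (Jideal ℓ).restrictScalars ℂ ⊔
      Submodule.span ℂ (Set.range (normalMonomial ℓ n)) := by
  set W := (Jideal ℓ).restrictScalars ℂ ⊔ Submodule.span ℂ (Set.range (normalMonomial ℓ n))
  let μ : Multiset (Fin (ℓ + 1)) → ℕ := fun s => (s.map fun i : Fin (ℓ + 1) => (i : ℕ) ^ 2).sum
  have hμ : ∀ s : Multiset (Fin (ℓ + 1)), s.card = n → μ s ≤ n * ℓ ^ 2 := by
    intro s hs
    have := Multiset.sum_le_card_nsmul (s.map fun i : Fin (ℓ + 1) => (i : ℕ) ^ 2) (ℓ ^ 2) (by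
      intro x hx
      obtain ⟨i, -, rfl⟩ := Multiset.mem_map.1 hx
      exact Nat.pow_le_pow_left (by omega) 2)
    rwa [Multiset.card_map, hs, smul_eq_mul] at this
  induction hN : n * ℓ ^ 2 - μ s using Nat.strong_induction_on generalizing s with
  | _ N ih =>
    rcases Nat.lt_or_ge (s.filter (· ∈ Finset.Ioo (0 : Fin (ℓ + 1)) (Fin.last ℓ))).card 3 with h | h
    · exact Submodule.mem_sup_right (Submodule.subset_span (prod_mem_range_normalMonomial hs h))
    · obtain ⟨t, ht3⟩ := Multiset.card_pos_iff_exists_mem.1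
        ((Nat.choose_pos h).trans_eq (Multiset.card_powersetCard 3 _).symm)
      obtain ⟨htle, ht⟩ := Multiset.mem_powersetCard.1 ht3
      obtain ⟨i, j, k, rfl⟩ := Multiset.card_eq_three.1 ht
      have hmem : ∀ x ∈ ({i, j, k} : Multiset (Fin (ℓ + 1))),
          x ∈ Finset.Ioo (0 : Fin (ℓ + 1)) (Fin.last ℓ) := fun x hx =>
        (Multiset.mem_filter.1 (Multiset.mem_of_le htle hx)).2
      obtain ⟨s', rfl⟩ := Multiset.le_iff_exists_add.1 (htle.trans (Multiset.filter_le _ _))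
      have hprod : ∀ x y z : Fin (ℓ + 1), ((({x, y, z} + s').map X).prod :
          MvPolynomial (Fin (ℓ + 1)) ℂ) = X x * X y * X z * (s'.map X).prod := by
        intro x y z
        simp [mul_assoc]
      have hμ' : ∀ x y z : Fin (ℓ + 1), μ ({x, y, z} + s') =
          (x : ℕ) ^ 2 + (y : ℕ) ^ 2 + (z : ℕ) ^ 2 + μ s' := by
        intro x y z
        simp [μ, add_assoc]
      rw [hprod]
      refine straighten hodd (fun p hp => Submodule.mem_sup_left hp) _ (hmem i (by simp))
        (hmem j (by simp)) (hmem k (by simp)) fun x y z hxyz => ?_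
      rw [← hprod]
      have hcard : ({x, y, z} + s').card = n := by simpa using hs
      refine ih _ ?_ _ hcard rfl
      have h1 := hμ _ hcard
      rw [hμ'] at h1 hN ⊢
      omega

lemma homogeneousSubmodule_le_sup {ℓ : ℕ} (n : ℕ) (hodd : Odd ℓ) :
    homogeneousSubmodule (Fin (ℓ + 1)) ℂ n ≤ (Jideal ℓ).restrictScalars ℂ ⊔
      Submodule.span ℂ (Set.range (normalMonomial ℓ n)) := by
  intro f hf
  rw [f.as_sum]
  refine Submodule.sum_mem _ fun m hm => ?_
  have hdeg : m.toMultiset.card = n := by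
    rw [Finsupp.card_toMultiset, ← hf (mem_support_iff.1 hm), Finsupp.weight_apply]
    simp only [Pi.one_apply, smul_eq_mul, mul_one]
    rfl
  have hmon : monomial m (f.coeff m) = f.coeff m • (m.toMultiset.map X).prod := by
    rw [monomial_eq, smul_eq_C_mul, Finsupp.toMultiset_map, Finsupp.prod_toMultiset,
      Finsupp.prod_mapDomain_index (by simp) (by simp [pow_add])]
  rw [hmon]
  exact Submodule.smul_mem _ _ (prod_mem_sup n hodd _ hdeg)

lemma finrank_le {ℓ n : ℕ} (hℓ : 1 ≤ ℓ) (hodd : Odd ℓ) (hn : 2 ≤ n) :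
    Module.finrank ℂ (Submodule.map (Ideal.Quotient.mkₐ ℂ (Jideal ℓ)).toLinearMap
          (homogeneousSubmodule (Fin (ℓ + 1)) ℂ n)) ≤
      Nat.choose (ℓ + 2) 2 + (n - 2) * Nat.choose (ℓ + 1) 2 := by
  rw [← card_normalIndex hℓ hn]
  set q := (Ideal.Quotient.mkₐ ℂ (Jideal ℓ)).toLinearMap with hq
  have hle : Submodule.map q (homogeneousSubmodule (Fin (ℓ + 1)) ℂ n) ≤
      Submodule.span ℂ (Set.range (q ∘ normalMonomial ℓ n)) := by
    refine (Submodule.map_mono (homogeneousSubmodule_le_sup n hodd)).trans ?_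
    rw [Submodule.map_sup, Submodule.map_span, ← Set.range_comp, sup_le_iff]
    refine ⟨?_, le_rfl⟩
    rintro _ ⟨p, hp, rfl⟩
    have : q p = 0 := Ideal.Quotient.eq_zero_iff_mem.2 hp
    rw [this]
    exact Submodule.zero_mem _
  have hfin : FiniteDimensional ℂ (Submodule.span ℂ (Set.range (q ∘ normalMonomial ℓ n))) :=
    FiniteDimensional.span_of_finite ℂ (Set.finite_range _)
  exact (Submodule.finrank_mono hle).trans (finrank_range_le_card _)

lemma choose_add_mul_choose_eq_sum {n : ℕ} (r : ℕ) (hn : 2 ≤ n) :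
    Nat.choose (2 * r + 1 + 2) 2 + (n - 2) * Nat.choose (2 * r + 1 + 1) 2 =
      ∑ i ∈ Finset.range (r + 1), (n * (2 * r + 1) + 1 - 4 * i) := by
  obtain ⟨m, rfl⟩ := Nat.exists_eq_add_of_le' hn
  have hsum : ∀ j ≤ r + 1, ∑ i ∈ Finset.range j, ((m + 2) * (2 * r + 1) + 1 - 4 * i) + 2 * j * j =
      j * ((m + 2) * (2 * r + 1) + 3) := by
    intro j
    induction j with
    | zero => simp
    | succ j ih =>
      intro hj
      have h1 := ih (by omega)
      have h2 : 4 * j ≤ (m + 2) * (2 * r + 1) + 1 := by nlinarith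
      rw [Finset.sum_range_succ]
      generalize (m + 2) * (2 * r + 1) = L at *
      obtain ⟨w, hw⟩ : ∃ w, L + 1 - 4 * j = w := ⟨_, rfl⟩
      have hL : L + 1 = 4 * j + w := by omega
      rw [hw]
      linarith
  have h1 := hsum (r + 1) le_rfl
  have h2 : (2 * r + 1 + 1).choose 2 = (r + 1) * (2 * r + 1) := by
    rw [Nat.choose_two_right, Nat.add_sub_cancel,
      show (2 * r + 1 + 1) * (2 * r + 1) = (r + 1) * (2 * r + 1) * 2 by ring,
      Nat.mul_div_cancel _ two_pos]
  have h3 : (2 * r + 1 + 2).choose 2 = (r + 1) * (2 * r + 1) + (2 * r + 2) := by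
    rw [Nat.choose_succ_succ' (2 * r + 1 + 1) 1, Nat.choose_one_right, h2, add_comm]
  rw [h2, h3, Nat.add_sub_cancel]
  nlinarith

/-- For odd `ℓ ≥ 3` and `n ≥ 2`, the degree-`n` component of `ℂ[x_0,…,x_ℓ]/J` has dimension
`C(ℓ+2,2) + (n−2)·C(ℓ+1,2) = Σ_{i=0}^{(ℓ−1)/2} (nℓ + 1 − 4i)`. -/
theorem dim_poisson_closure_odd (ℓ n : ℕ) (hℓ : 3 ≤ ℓ) (hodd : Odd ℓ) (hn : 2 ≤ n) :
    Module.finrank ℂ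
        (Submodule.map (Ideal.Quotient.mkₐ ℂ (Jideal ℓ)).toLinearMap
          (homogeneousSubmodule (Fin (ℓ + 1)) ℂ n)) =
      Nat.choose (ℓ + 2) 2 + (n - 2) * Nat.choose (ℓ + 1) 2 ∧
    Nat.choose (ℓ + 2) 2 + (n - 2) * Nat.choose (ℓ + 1) 2 =
      ∑ i ∈ Finset.range ((ℓ - 1) / 2 + 1), (n * ℓ + 1 - 4 * i) := by
  obtain ⟨r, rfl⟩ := hodd
  have hr : (2 * r + 1 - 1) / 2 + 1 = r + 1 := by omega
  rw [hr, choose_add_mul_choose_eq_sum r hn]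
  refine ⟨le_antisymm ?_ (sum_le_finrank hn), rfl⟩
  rw [← choose_add_mul_choose_eq_sum r hn]
  exact finrank_le (by omega) ⟨r, rfl⟩ hn
end

section
/- Let ℓ ≥ 3 be an odd integer. Then the family of polynomials {P_{abc} : 0 ≤ a < b < c ≤ ℓ} in ℂ[x_0,…,x_ℓ] is linearly independent over ℂ. Equivalently, the Jacobian map c = E ∧ F ∧ H from the third exterior power Λ³(V_ℓ) to the degree-3 component of the symmetric algebra ℂ[x_0,…,x_ℓ] is injective. -/
open MvPolynomial

/-- The exponent vector of the monomial `x_i x_j x_k`. -/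
noncomputable def cubicExponent {n : ℕ} (i j k : Fin n) : Fin n →₀ ℕ :=
  Finsupp.single i 1 + Finsupp.single j 1 + Finsupp.single k 1

/-- The additive weight on exponent vectors giving `x_i` the weight `i²`. -/
noncomputable def squareWeight {n : ℕ} : (Fin n →₀ ℕ) →+ ℤ :=
  Finsupp.weight fun i : Fin n => (i : ℤ) ^ 2

theorem squareWeight_cubicExponent {n : ℕ} (i j k : Fin n) :
    squareWeight (cubicExponent i j k) = (i : ℤ) ^ 2 + (j : ℤ) ^ 2 + (k : ℤ) ^ 2 := by
  simp [squareWeight, cubicExponent, Finsupp.weight_single]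

theorem cubicExponent_injective_of_le {n : ℕ} {i j k i' j' k' : Fin n}
    (hij : i ≤ j) (hjk : j ≤ k) (hij' : i' ≤ j') (hjk' : j' ≤ k')
    (h : cubicExponent i j k = cubicExponent i' j' k') : i = i' ∧ j = j' ∧ k = k' := by
  have h₁ := congrArg Finsupp.toMultiset h
  simp only [cubicExponent, map_add, Finsupp.toMultiset_single, one_smul] at h₁
  have h₂ : ([i, j, k] : Multiset (Fin n)) = ([i', j', k'] : List (Fin n)) := h₁
  have h₃ : [i, j, k] = [i', j', k'] :=
    (Multiset.coe_eq_coe.mp h₂).eq_of_pairwise (le := (· ≤ ·))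
      (fun _ _ _ _ => le_antisymm)
      (by simp [hij, hjk, hij.trans hjk]) (by simp [hij', hjk', hij'.trans hjk'])
  simpa using h₃

theorem Ederiv_mul_Fderiv_mul_Hderiv (ℓ : ℕ) (p r s : Fin (ℓ + 1)) :
    Ederiv ℓ (X p) * Fderiv ℓ (X r) * Hderiv ℓ (X s) =
      monomial (cubicExponent (p - 1) (r + 1) s)
        (((p : ℕ) : ℂ) * ((ℓ : ℂ) - ((r : ℕ) : ℂ)) * ((ℓ : ℂ) - 2 * ((s : ℕ) : ℂ))) := by
  simp only [Ederiv, Fderiv, Hderiv, mkDerivation_X, C_mul_X_eq_monomial, monomial_mul,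
    cubicExponent]

theorem eq_and_squareWeight_of_coeff_ne_zero {ℓ : ℕ} {p r s : Fin (ℓ + 1)}
    {d : Fin (ℓ + 1) →₀ ℕ}
    (h : coeff d (Ederiv ℓ (X p) * Fderiv ℓ (X r) * Hderiv ℓ (X s)) ≠ 0) :
    d = cubicExponent (p - 1) (r + 1) s ∧
      squareWeight d = ((p : ℤ) - 1) ^ 2 + ((r : ℤ) + 1) ^ 2 + (s : ℤ) ^ 2 := by
  rw [Ederiv_mul_Fderiv_mul_Hderiv, coeff_monomial] at h
  split_ifs at h with hd
  · refine ⟨hd.symm, ?_⟩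
    have hp : p ≠ 0 := by
      rintro rfl
      simp at h
    have hr : r ≠ Fin.last ℓ := by
      rintro rfl
      simp at h
    have hp' : 1 ≤ (p : ℕ) := Nat.one_le_iff_ne_zero.mpr (Fin.val_ne_zero_iff.mpr hp)
    rw [← hd, squareWeight_cubicExponent, Fin.val_sub_one_of_ne_zero hp,
      Fin.val_add_one_of_lt (Fin.lt_last_iff_ne_last.mpr hr)]
    push_cast [hp']
    ring
  · exact absurd rfl h

theorem Pabc_eq (ℓ : ℕ) (a b c : Fin (ℓ + 1)) :
    Pabc ℓ a b c =
      Ederiv ℓ (X a) * Fderiv ℓ (X b) * Hderiv ℓ (X c)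
        - Ederiv ℓ (X a) * Fderiv ℓ (X c) * Hderiv ℓ (X b)
        - Ederiv ℓ (X b) * Fderiv ℓ (X a) * Hderiv ℓ (X c)
        + Ederiv ℓ (X b) * Fderiv ℓ (X c) * Hderiv ℓ (X a)
        + Ederiv ℓ (X c) * Fderiv ℓ (X a) * Hderiv ℓ (X b)
        - Ederiv ℓ (X c) * Fderiv ℓ (X b) * Hderiv ℓ (X a) := by
  rw [Pabc, Matrix.det_fin_three]
  simp
  ring

/-- Among the monomials of `P_{abc}`, the one of least weight is `x_{a+1} x_b x_{c-1}`. -/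
theorem coeff_Pabc_of_squareWeight_le {ℓ : ℕ} {a b c : Fin (ℓ + 1)} (hab : a < b) (hbc : b < c)
    {d : Fin (ℓ + 1) →₀ ℕ}
    (hd : squareWeight d ≤ squareWeight (cubicExponent (c - 1) (a + 1) b)) :
    coeff d (Pabc ℓ a b c) = coeff d (Ederiv ℓ (X c) * Fderiv ℓ (X a) * Hderiv ℓ (X b)) := by
  have hc : c ≠ 0 := (Fin.zero_le b |>.trans_lt hbc).ne'
  have ha : a < Fin.last ℓ := hab.trans_le (Fin.le_last b)
  have hab' : (a : ℤ) < b := by exact_mod_cast hab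
  have hbc' : (b : ℤ) < c := by exact_mod_cast hbc
  have hc' : 1 ≤ (c : ℕ) := Nat.one_le_iff_ne_zero.mpr (Fin.val_ne_zero_iff.mpr hc)
  rw [squareWeight_cubicExponent, Fin.val_sub_one_of_ne_zero hc, Fin.val_add_one_of_lt ha] at hd
  push_cast [hc'] at hd
  have vanish : ∀ p r s : Fin (ℓ + 1),
      ((c : ℤ) - 1) ^ 2 + ((a : ℤ) + 1) ^ 2 + (b : ℤ) ^ 2 <
        ((p : ℤ) - 1) ^ 2 + ((r : ℤ) + 1) ^ 2 + (s : ℤ) ^ 2 →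
      coeff d (Ederiv ℓ (X p) * Fderiv ℓ (X r) * Hderiv ℓ (X s)) = 0 := by
    intro p r s hlt
    by_contra h
    have := (eq_and_squareWeight_of_coeff_ne_zero h).2
    linarith
  rw [Pabc_eq]
  simp only [coeff_add, coeff_sub]
  rw [vanish a b c (by linarith), vanish a c b (by linarith), vanish b a c (by linarith),
    vanish b c a (by linarith), vanish c b a (by linarith)]
  ring

/-- A family of polynomials is linearly independent if distinguished monomials of its members
are pairwise distinct and a member contains no other monomial of at most the weight of its
distinguished one. -/
theorem linearIndependent_of_coeff_of_weight {ι σ R W : Type*} [CommRing R] [IsDomain R]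
    [LinearOrder W] (P : ι → MvPolynomial σ R) (m : ι → σ →₀ ℕ) (w : (σ →₀ ℕ) → W)
    (hm : Function.Injective m) (hlead : ∀ i, coeff (m i) (P i) ≠ 0)
    (hlow : ∀ i d, w d ≤ w (m i) → d ≠ m i → coeff d (P i) = 0) :
    LinearIndependent R P := by
  classical
  rw [linearIndependent_iff']
  intro s g hg i hi
  by_contra hgi
  obtain ⟨t, ht, hmin⟩ := (s.filter fun j => g j ≠ 0).exists_min_image (fun j => w (m j))
    ⟨i, Finset.mem_filter.mpr ⟨hi, hgi⟩⟩
  obtain ⟨hts, hgt⟩ := Finset.mem_filter.mp ht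
  have hcoeff := congrArg (coeff (m t)) hg
  rw [coeff_sum, Finset.sum_eq_single_of_mem t hts] at hcoeff
  · rw [coeff_smul, coeff_zero, smul_eq_mul] at hcoeff
    exact mul_ne_zero hgt (hlead t) hcoeff
  · intro j hj hjt
    rw [coeff_smul, smul_eq_mul]
    by_cases hgj : g j = 0
    · rw [hgj, zero_mul]
    · rw [hlow j (m t) (hmin j (Finset.mem_filter.mpr ⟨hj, hgj⟩))
        (fun h => hjt (hm h).symm), mul_zero]

/-- For odd `ℓ ≥ 3`, the family `{P_{abc} : a < b < c}` is linearly independent over `ℂ`;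
equivalently, the Jacobian map `Λ³ V_ℓ → S³(V_ℓ)` is injective. -/
theorem jacobian_map_injective (ℓ : ℕ) (hℓ : 3 ≤ ℓ) (hodd : Odd ℓ) :
    LinearIndependent ℂ
      (fun t : {t : Fin (ℓ + 1) × Fin (ℓ + 1) × Fin (ℓ + 1) // t.1 < t.2.1 ∧ t.2.1 < t.2.2} =>
        Pabc ℓ t.1.1 t.1.2.1 t.1.2.2) := by
  refine linearIndependent_of_coeff_of_weight _
    (fun t => cubicExponent (t.1.2.2 - 1) (t.1.1 + 1) t.1.2.1) squareWeight ?_ ?_ ?_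
  · rintro ⟨⟨a, b, c⟩, hab, hbc⟩ ⟨⟨a', b', c'⟩, hab', hbc'⟩ h
    dsimp only at hab hbc hab' hbc' h
    have rotate : ∀ i j k : Fin (ℓ + 1), cubicExponent i j k = cubicExponent j k i :=
      fun i j k => by simp only [cubicExponent]; abel
    have sorted : ∀ a b c : Fin (ℓ + 1), a < b → b < c → a + 1 ≤ b ∧ b ≤ c - 1 := by
      intro a b c hab hbc
      have hc : c ≠ 0 := (Fin.zero_le b |>.trans_lt hbc).ne'
      have ha : a < Fin.last ℓ := hab.trans_le (Fin.le_last b)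
      rw [Fin.le_def, Fin.le_def, Fin.val_sub_one_of_ne_zero hc, Fin.val_add_one_of_lt ha]
      rw [Fin.lt_def] at hab hbc
      omega
    rw [rotate, rotate (c' - 1)] at h
    obtain ⟨h₁, h₂⟩ := sorted a b c hab hbc
    obtain ⟨h₁', h₂'⟩ := sorted a' b' c' hab' hbc'
    obtain ⟨ha, hb, hc⟩ := cubicExponent_injective_of_le h₁ h₂ h₁' h₂' h
    simp [add_right_cancel ha, hb, sub_left_injective hc]
  · rintro ⟨⟨a, b, c⟩, hab, hbc⟩
    dsimp only at hab hbc ⊢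
    rw [coeff_Pabc_of_squareWeight_le hab hbc le_rfl, Ederiv_mul_Fderiv_mul_Hderiv,
      coeff_monomial, if_pos rfl]
    rw [Fin.lt_def] at hab hbc
    refine mul_ne_zero (mul_ne_zero ?_ ?_) ?_
    · exact_mod_cast (by omega : (c : ℕ) ≠ 0)
    · rw [sub_ne_zero]
      exact_mod_cast (by omega : ℓ ≠ (a : ℕ))
    · rw [sub_ne_zero]
      obtain ⟨k, hk⟩ := hodd
      exact_mod_cast (by omega : ℓ ≠ 2 * (b : ℕ))
  · rintro ⟨⟨a, b, c⟩, hab, hbc⟩ d hd hne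
    dsimp only at hab hbc hd hne ⊢
    rw [coeff_Pabc_of_squareWeight_le hab hbc hd]
    by_contra h
    exact hne (eq_and_squareWeight_of_coeff_ne_zero h).1
end

section
/- Let ℓ ≥ 3 be an odd integer and let 0 ≤ a < b < c ≤ ℓ. Then the coefficient of the monomial x_{a+1}·x_b·x_{c−1} in the polynomial P_{abc} equals (ℓ−a)(ℓ−2b)c, and this number is nonzero. -/
open MvPolynomial

theorem coeff_mul_three_scaled_vars {σ R : Type*} [CommSemiring R] [DecidableEq σ]
    (m : σ →₀ ℕ) (r s t : R) (i j k : σ) :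
    coeff m (C r * X i * (C s * X j) * (C t * X k)) =
      if Finsupp.single i 1 + Finsupp.single j 1 + Finsupp.single k 1 = m
        then r * s * t else 0 := by
  simp only [X, C_mul_monomial, monomial_mul, coeff_monomial, mul_one]

theorem coeff_mul_three_scaled_vars_eq_zero {σ R : Type*} [CommSemiring R]
    {p q u : σ} {r s t : R} {i j k : σ} (v : σ) (hv : v = i ∨ v = j ∨ v = k)
    (hp : v ≠ p) (hq : v ≠ q) (hu : v ≠ u) :
    coeff (Finsupp.single p 1 + Finsupp.single q 1 + Finsupp.single u 1)
      (C r * X i * (C s * X j) * (C t * X k)) = 0 := by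
  classical
  rw [coeff_mul_three_scaled_vars, if_neg]
  intro h
  have h' := DFunLike.congr_fun h v
  simp only [Finsupp.add_apply, Finsupp.single_apply, hp.symm, hq.symm, hu.symm,
    if_false] at h'
  rcases hv with rfl | rfl | rfl <;> simp at h'

/-- For odd `ℓ ≥ 3` and `0 ≤ a < b < c ≤ ℓ`, the coefficient of `x_{a+1}·x_b·x_{c−1}` in
`P_{abc}` equals `(ℓ−a)(ℓ−2b)c`, which is nonzero. -/
theorem coeff_terminal_monomial (ℓ : ℕ) (hℓ : 3 ≤ ℓ) (hodd : Odd ℓ)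
    (a b c : Fin (ℓ + 1)) (hab : a < b) (hbc : b < c) :
    MvPolynomial.coeff
        (Finsupp.single (a + 1) 1 + Finsupp.single b 1 + Finsupp.single (c - 1) 1)
        (Pabc ℓ a b c) =
      ((ℓ : ℂ) - ((a : ℕ) : ℂ)) * ((ℓ : ℂ) - 2 * ((b : ℕ) : ℂ)) * ((c : ℕ) : ℂ) ∧
    ((ℓ : ℂ) - ((a : ℕ) : ℂ)) * ((ℓ : ℂ) - 2 * ((b : ℕ) : ℂ)) * ((c : ℕ) : ℂ) ≠ 0 := by
  have hab' : (a : ℕ) < b := hab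
  have hbc' : (b : ℕ) < c := hbc
  have hc := c.isLt
  have ha1 : ((a + 1 : Fin (ℓ + 1)) : ℕ) = a + 1 :=
    Fin.val_add_one_of_lt' (by omega)
  have hc1 : ((c - 1 : Fin (ℓ + 1)) : ℕ) = c - 1 :=
    Fin.val_sub_one_of_ne_zero (Fin.val_ne_zero_iff.mp (by omega))
  constructor
  · have haa : a ≠ a + 1 ∧ a ≠ b ∧ a ≠ c - 1 := by
      refine ⟨?_, ?_, ?_⟩ <;> rw [Ne, Fin.ext_iff] <;> omega
    have hcc : c ≠ a + 1 ∧ c ≠ b ∧ c ≠ c - 1 := by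
      refine ⟨?_, ?_, ?_⟩ <;> rw [Ne, Fin.ext_iff] <;> omega
    simp only [Pabc, Matrix.det_fin_three, Ederiv, Fderiv, Hderiv, mkDerivation_X,
      Matrix.of_apply, Matrix.cons_val, coeff_sub, coeff_add]
    rw [coeff_mul_three_scaled_vars_eq_zero (k := c) c (by simp) hcc.1 hcc.2.1 hcc.2.2,
      coeff_mul_three_scaled_vars_eq_zero (j := b - 1) (k := c) c (by simp)
        hcc.1 hcc.2.1 hcc.2.2,
      coeff_mul_three_scaled_vars_eq_zero (i := a) (j := b - 1) a (by simp)
        haa.1 haa.2.1 haa.2.2,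
      coeff_mul_three_scaled_vars_eq_zero (i := a) (j := b + 1) a (by simp)
        haa.1 haa.2.1 haa.2.2,
      coeff_mul_three_scaled_vars _ _ _ _ (a + 1) b (c - 1), if_pos rfl]
    rcases eq_or_ne a 0 with h0 | h0
    · simp [h0]
    · have hp := Fin.val_sub_one_of_ne_zero h0
      have hpos : (a : ℕ) ≠ 0 := Fin.val_ne_zero_iff.mpr h0
      rw [coeff_mul_three_scaled_vars_eq_zero (i := a - 1) (a - 1) (by simp)
        (by rw [Ne, Fin.ext_iff]; omega) (by rw [Ne, Fin.ext_iff]; omega)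
        (by rw [Ne, Fin.ext_iff]; omega)]
      ring
  · refine mul_ne_zero (mul_ne_zero ?_ ?_) ?_
    · rw [sub_ne_zero]
      exact_mod_cast (by omega : ℓ ≠ a)
    · rw [sub_ne_zero]
      obtain ⟨k, rfl⟩ := hodd
      exact_mod_cast (by omega : 2 * k + 1 ≠ 2 * (b : ℕ))
    · exact_mod_cast (by omega : (c : ℕ) ≠ 0)
end

section
/- For all integers n ≥ 2 and ℓ ≥ 1, the cardinality of the set T_{n,ℓ} equals C(ℓ+2,2) + (n−2)·C(ℓ+1,2). -/
/-- `T_{n,ℓ}`: the set of tuples `(k_0,…,k_ℓ)` of nonnegative integers with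
`k_0 + ⋯ + k_ℓ = n` and `k_0 + k_ℓ ≥ n − 2`. -/
def Tnl (n ℓ : ℕ) : Finset (Fin (ℓ + 1) → ℕ) :=
  (Finset.Nat.antidiagonalTuple (ℓ + 1) n).filter fun k => n - 2 ≤ k 0 + k (Fin.last ℓ)

theorem card_antidiagonalTuple (m s : ℕ) :
    (Finset.Nat.antidiagonalTuple m s).card = Nat.multichoose m s := by
  have h := Finset.card_finsuppAntidiag_nat_eq_multichoose (s := (Finset.univ : Finset (Fin m))) s
  rw [Finset.card_univ, Fintype.card_fin] at h
  rw [← h]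
  refine Finset.card_nbij' (fun f => Finsupp.equivFunOnFinite.symm f) (fun f => f) ?_ ?_ ?_ ?_
  · intro f hf
    simpa [Finset.Nat.mem_antidiagonalTuple, Finset.mem_finsuppAntidiag] using hf
  · intro f hf
    simpa [Finset.Nat.mem_antidiagonalTuple, Finset.mem_finsuppAntidiag] using hf
  · intro f _
    rfl
  · intro f _
    ext
    rfl

/-- Splitting off the two outer entries of a tuple and grouping by the sum of the inner ones. -/
theorem card_Tnl_succ_eq_sum (n m : ℕ) (hn : 2 ≤ n) :
    (Tnl n (m + 1)).card = ∑ s ∈ Finset.range 3, (n - s + 1) * Nat.multichoose m s := by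
  trans ((Finset.range 3).sigma fun s =>
    Finset.HasAntidiagonal.antidiagonal (n - s) ×ˢ Finset.Nat.antidiagonalTuple m s).card
  · refine Finset.card_nbij'
      (fun k => ⟨∑ i : Fin m, k i.castSucc.succ, (k 0, k (Fin.last (m + 1))),
        fun i => k i.castSucc.succ⟩)
      (fun x => Fin.cons x.2.1.1 (Fin.snoc x.2.2 x.2.1.2 : Fin (m + 1) → ℕ)) ?_ ?_ ?_ ?_
    · intro k hk
      simp only [Tnl, Finset.coe_filter, Set.mem_ofPred_eq, Finset.Nat.mem_antidiagonalTuple,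
        Fin.sum_univ_succ k, Fin.sum_univ_castSucc (fun i => k (Fin.succ i)), Fin.succ_last] at hk
      simp only [Finset.mem_coe, Finset.mem_sigma, Finset.mem_range, Finset.mem_product,
        Finset.HasAntidiagonal.mem_antidiagonal, Finset.Nat.mem_antidiagonalTuple, and_true]
      simp only [Nat.succ_eq_add_one] at hk
      omega
    · rintro ⟨s, ⟨a, b⟩, f⟩ h
      simp only [Finset.mem_coe, Finset.mem_sigma, Finset.mem_range, Finset.mem_product,
        Finset.HasAntidiagonal.mem_antidiagonal, Finset.Nat.mem_antidiagonalTuple] at h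
      simp only [Tnl, Finset.coe_filter, Set.mem_ofPred_eq, Finset.Nat.mem_antidiagonalTuple,
        Fin.sum_cons, Fin.sum_snoc, Fin.cons_zero, ← Fin.succ_last, Fin.cons_succ, Fin.snoc_last]
      omega
    · intro k _
      funext i
      refine Fin.cases rfl (fun j => ?_) i
      refine Fin.lastCases ?_ (fun t => ?_) j <;> simp
    · rintro ⟨s, ⟨a, b⟩, f⟩ h
      simp only [Finset.mem_coe, Finset.mem_sigma, Finset.mem_product,
        Finset.Nat.mem_antidiagonalTuple] at h
      obtain ⟨-, -, rfl⟩ := h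
      simp [← Fin.succ_last]
  · simp [Finset.card_sigma, card_antidiagonalTuple]

/-- For `n ≥ 2` and `ℓ ≥ 1`: `|T_{n,ℓ}| = C(ℓ+2,2) + (n−2)·C(ℓ+1,2)`. -/
theorem card_Tnl (n ℓ : ℕ) (hn : 2 ≤ n) (hℓ : 1 ≤ ℓ) :
    (Tnl n ℓ).card = Nat.choose (ℓ + 2) 2 + (n - 2) * Nat.choose (ℓ + 1) 2 := by
  obtain ⟨m, rfl⟩ := Nat.exists_eq_add_of_le' hℓ
  obtain ⟨p, rfl⟩ := Nat.exists_eq_add_of_le' hn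
  have h₂ : Nat.multichoose m 2 = (m + 1).choose 2 := by
    rw [Nat.multichoose_eq]
    rfl
  have h₃ : (m + 2).choose 2 = m + 1 + (m + 1).choose 2 := by
    rw [Nat.choose_succ_succ' (m + 1) 1, Nat.choose_one_right]
  have h₄ : (m + 3).choose 2 = m + 2 + (m + 2).choose 2 := by
    rw [Nat.choose_succ_succ' (m + 2) 1, Nat.choose_one_right]
  rw [card_Tnl_succ_eq_sum _ _ hn]
  simp only [Finset.sum_range_succ, Finset.sum_range_zero, Nat.multichoose_zero_right,
    Nat.multichoose_one_right, h₂, Nat.add_sub_cancel, Nat.sub_zero, add_assoc, Nat.reduceAdd,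
    h₃, h₄, show p + 2 - 1 = p + 1 from rfl]
  ring
end

section
/- Let d ≥ 1, m ≥ 0 be integers and let i, j ≥ 0 be integers with i + j ≤ d. Then the coefficient of the monomial x_0^i·x_1^{d−i−j}·x_2^j in the polynomial F^m(x_0^d) ∈ ℂ[x_0,x_1,x_2] is a nonnegative integer, and it is strictly positive if and only if i − j = d − m. -/
open MvPolynomial

/-- The derivation `E` on `ℂ[x_0,x_1,x_2]` with `E(x_0)=0`, `E(x_1)=x_0`, `E(x_2)=2x_1`. -/
noncomputable def E2 : Derivation ℂ (MvPolynomial (Fin 3) ℂ) (MvPolynomial (Fin 3) ℂ) :=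
  MvPolynomial.mkDerivation ℂ ![0, X 0, 2 * X 1]

/-- The derivation `F` on `ℂ[x_0,x_1,x_2]` with `F(x_0)=2x_1`, `F(x_1)=x_2`, `F(x_2)=0`. -/
noncomputable def F2 : Derivation ℂ (MvPolynomial (Fin 3) ℂ) (MvPolynomial (Fin 3) ℂ) :=
  MvPolynomial.mkDerivation ℂ ![2 * X 1, X 2, 0]

/-- The derivation `H` on `ℂ[x_0,x_1,x_2]` with `H(x_0)=2x_0`, `H(x_1)=0`, `H(x_2)=−2x_2`. -/
noncomputable def H2 : Derivation ℂ (MvPolynomial (Fin 3) ℂ) (MvPolynomial (Fin 3) ℂ) :=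
  MvPolynomial.mkDerivation ℂ ![2 * X 0, 0, -2 * X 2]

theorem F2_apply (p : MvPolynomial (Fin 3) ℂ) :
    F2 p = 2 * (X 1 * pderiv 0 p) + X 2 * pderiv 1 p := by
  have h : F2 = (2 * X 1 : MvPolynomial (Fin 3) ℂ) • pderiv 0 +
      (X 2 : MvPolynomial (Fin 3) ℂ) • pderiv 1 := by
    refine derivation_ext fun s => ?_
    fin_cases s <;> simp [F2, mkDerivation_X, pderiv_X]
  rw [h]
  simp [mul_assoc]

theorem coeff_F2 (n : Fin 3 →₀ ℕ) (p : MvPolynomial (Fin 3) ℂ) :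
    coeff n (F2 p) =
      (if n 1 = 0 then 0 else
        2 * ((n 0 + 1) * coeff (n - Finsupp.single 1 1 + Finsupp.single 0 1) p)) +
      (if n 2 = 0 then 0 else
        (n 1 + 1) * coeff (n - Finsupp.single 2 1 + Finsupp.single 1 1) p) := by
  have h2 : (2 : MvPolynomial (Fin 3) ℂ) = C 2 := (map_ofNat C 2).symm
  rw [F2_apply, h2, coeff_add, coeff_C_mul, coeff_X_mul', coeff_X_mul']
  simp only [coeff_pderiv, Finsupp.mem_support_iff]
  split_ifs <;> simp_all [mul_comm]

theorem coeff_F2_iterate (d m : ℕ) (n : Fin 3 →₀ ℕ) :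
    ∃ N : ℕ, coeff n ((fun p => F2 p)^[m] (X 0 ^ d)) = (N : ℂ) ∧
      (0 < N ↔ n 0 + n 1 + n 2 = d ∧ n 1 + 2 * n 2 = m) := by
  induction m generalizing n with
  | zero =>
    refine ⟨if Finsupp.single 0 d = n then 1 else 0, by simp [coeff_X_pow], ?_⟩
    have : Finsupp.single 0 d = n ↔ n 0 = d ∧ n 1 = 0 ∧ n 2 = 0 := by
      rw [Finsupp.ext_iff, Fin.forall_fin_succ, Fin.forall_fin_succ, Fin.forall_fin_succ]
      simp [eq_comm]
    split_ifs with h <;> rw [this] at h <;> simp <;> omega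
  | succ m ih =>
    obtain ⟨A, hA, hA'⟩ := ih (n - Finsupp.single 1 1 + Finsupp.single 0 1)
    obtain ⟨B, hB, hB'⟩ := ih (n - Finsupp.single 2 1 + Finsupp.single 1 1)
    refine ⟨(if n 1 = 0 then 0 else 2 * ((n 0 + 1) * A)) +
      (if n 2 = 0 then 0 else (n 1 + 1) * B), ?_, ?_⟩
    · rw [Function.iterate_succ_apply', coeff_F2, hA, hB]
      push_cast
      rfl
    · simp at hA' hB'
      split_ifs <;> simp [hA', hB'] <;> omega

/-- The coefficient of `x_0^i·x_1^{d−i−j}·x_2^j` in `F^m(x_0^d)` is a nonnegative integer,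
strictly positive iff `i − j = d − m`. -/
theorem coeff_F_iter_pow (d m i j : ℕ) (hd : 1 ≤ d) (hij : i + j ≤ d) :
    ∃ N : ℕ,
      MvPolynomial.coeff
          (Finsupp.single (0 : Fin 3) i + Finsupp.single (1 : Fin 3) (d - i - j) +
            Finsupp.single (2 : Fin 3) j)
          ((fun p => F2 p)^[m] (X 0 ^ d)) = (N : ℂ) ∧
      (0 < N ↔ (i : ℤ) - (j : ℤ) = (d : ℤ) - (m : ℤ)) := by
  obtain ⟨N, hN, hpos⟩ := coeff_F2_iterate d m
    (Finsupp.single 0 i + Finsupp.single 1 (d - i - j) + Finsupp.single 2 j)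
  refine ⟨N, hN, hpos.trans ?_⟩
  simp
  omega
end

section
/- Let d ≥ 1 and let m ≥ 0 be an odd integer. Then the polynomial F^m(x_0^d) ∈ ℂ[x_0,x_1,x_2] is divisible by x_1. -/
open MvPolynomial

/-- The subalgebra of polynomials that are even in `x_1`. -/
noncomputable def evenSubalgebra : Subalgebra ℂ (MvPolynomial (Fin 3) ℂ) :=
  Algebra.adjoin ℂ {X 0, X 1 ^ 2, X 2}

lemma X_zero_mem_evenSubalgebra : X 0 ∈ evenSubalgebra :=
  Algebra.subset_adjoin (by simp)

lemma X_one_sq_mem_evenSubalgebra : X 1 ^ 2 ∈ evenSubalgebra :=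
  Algebra.subset_adjoin (by simp)

lemma X_two_mem_evenSubalgebra : X 2 ∈ evenSubalgebra :=
  Algebra.subset_adjoin (by simp)

lemma F2_X_zero : F2 (X 0) = 2 * X 1 := by simp [F2, mkDerivation_X]

lemma F2_X_one : F2 (X 1) = X 2 := by simp [F2, mkDerivation_X]

lemma F2_X_two : F2 (X 2) = 0 := by simp [F2, mkDerivation_X]

/-- `F` sends polynomials even in `x_1` to polynomials odd in `x_1`. -/
lemma exists_F2_eq_X_one_mul {p : MvPolynomial (Fin 3) ℂ} (hp : p ∈ evenSubalgebra) :
    ∃ q ∈ evenSubalgebra, F2 p = X 1 * q := by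
  induction hp using Algebra.adjoin_induction with
  | mem x hx =>
    rcases hx with rfl | rfl | rfl
    · exact ⟨2, ofNat_mem _ 2, by rw [F2_X_zero, mul_comm]⟩
    · refine ⟨2 * X 2, mul_mem (ofNat_mem _ 2) X_two_mem_evenSubalgebra, ?_⟩
      rw [sq, Derivation.leibniz, F2_X_one, smul_eq_mul]
      ring
    · exact ⟨0, zero_mem _, by rw [F2_X_two, mul_zero]⟩
  | algebraMap r => exact ⟨0, zero_mem _, by rw [Derivation.map_algebraMap, mul_zero]⟩
  | add x y _ _ hx hy =>
    obtain ⟨a, ha, hxa⟩ := hx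
    obtain ⟨b, hb, hyb⟩ := hy
    exact ⟨a + b, add_mem ha hb, by rw [map_add, hxa, hyb, mul_add]⟩
  | mul x y hx' hy' hx hy =>
    obtain ⟨a, ha, hxa⟩ := hx
    obtain ⟨b, hb, hyb⟩ := hy
    refine ⟨x * b + y * a, add_mem (mul_mem hx' hb) (mul_mem hy' ha), ?_⟩
    rw [Derivation.leibniz, hxa, hyb, smul_eq_mul, smul_eq_mul]
    ring

lemma F2_F2_mem_evenSubalgebra {p : MvPolynomial (Fin 3) ℂ} (hp : p ∈ evenSubalgebra) :
    F2 (F2 p) ∈ evenSubalgebra := by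
  obtain ⟨q, hq, hpq⟩ := exists_F2_eq_X_one_mul hp
  obtain ⟨r, hr, hqr⟩ := exists_F2_eq_X_one_mul hq
  have h : F2 (F2 p) = X 1 ^ 2 * r + q * X 2 := by
    rw [hpq, Derivation.leibniz, hqr, F2_X_one, smul_eq_mul, smul_eq_mul]
    ring
  rw [h]
  exact add_mem (mul_mem X_one_sq_mem_evenSubalgebra hr) (mul_mem hq X_two_mem_evenSubalgebra)

lemma F2_iterate_two_mul_mem_evenSubalgebra {p : MvPolynomial (Fin 3) ℂ}
    (hp : p ∈ evenSubalgebra) (k : ℕ) : (fun p => F2 p)^[2 * k] p ∈ evenSubalgebra := by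
  induction k with
  | zero => exact hp
  | succ k ih =>
    rw [mul_add, mul_one, Function.iterate_succ_apply', Function.iterate_succ_apply']
    exact F2_F2_mem_evenSubalgebra ih

/-- For odd `m`, the polynomial `F^m(x_0^d)` is divisible by `x_1`. -/
theorem X1_dvd_F_iter_pow_odd (d m : ℕ) (hd : 1 ≤ d) (hm : Odd m) :
    (X 1 : MvPolynomial (Fin 3) ℂ) ∣ (fun p => F2 p)^[m] (X 0 ^ d) := by
  obtain ⟨k, rfl⟩ := hm
  obtain ⟨q, -, hq⟩ := exists_F2_eq_X_one_mul
    (F2_iterate_two_mul_mem_evenSubalgebra (pow_mem X_zero_mem_evenSubalgebra d) k)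
  exact ⟨q, (Function.iterate_succ_apply' _ (2 * k) _).trans hq⟩
end
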